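/- For every real number b there exists a constant C > 0 such that for every k ∈ ℕ there exists a finite simple graph H_k with at most C·k² vertices (the graph H_k is fixed and does not depend on the edge weights) with the following property: if the edge weights of H_k are independent random variables, each uniform on [b, b+1], and σ is a uniformly random cut of H_k independent of the weights, then the probability that there exists a 3-flip sequence improving from σ of length at least 2^{k−1} tends to 1 as k → ∞ (i.e., for every ε > 0 there is K such that for all k ≥ K this probability is at least 1 − ε). -/

import Mathlib

open Finset
open scoped Classical

namespace MaxCut

variable {V : Type*} [Fintype V]

/-- The value of a cut `σ` in graph `G` with weights `X`. -/
noncomputable def cutValue (G : SimpleGraph V) (X : Sym2 V → ℝ) (σ : V → ℝ) : ℝ :=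
  (1 / 2) * ∑ e ∈ Finset.univ.filter (fun e => e ∈ G.edgeSet),
    (1 - Sym2.lift ⟨fun u w => σ u * σ w, fun u w => by ring⟩ e) * X e

/-- Flip the vertices of `S` across the cut. -/
noncomputable def flip (σ : V → ℝ) (S : Finset V) : V → ℝ := fun v => if v ∈ S then -σ v else σ v

/-- The change in cut value caused by flipping all vertices of `S`. -/
noncomputable def impr (G : SimpleGraph V) (X : Sym2 V → ℝ) (σ : V → ℝ) (S : Finset V) : ℝ :=
  cutValue G X (flip σ S) - cutValue G X σ

/-- The cut obtained from `σ` by performing all moves of the flip sequence. -/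
noncomputable def applyList (σ : V → ℝ) : List (Finset V) → (V → ℝ)
  | [] => σ
  | S :: L => applyList (flip σ S) L

/-- A flip sequence is improving from `σ` if each step strictly increases the cut value. -/
def Improving (G : SimpleGraph V) (X : Sym2 V → ℝ) : (V → ℝ) → List (Finset V) → Prop
  | _, [] => True
  | σ, S :: L => 0 < impr G X σ S ∧ Improving G X (flip σ S) L

/-- A cut assigns `1` or `-1` to each vertex. -/
def IsCut (σ : V → ℝ) : Prop := ∀ v, σ v = 1 ∨ σ v = -1

/-- A local optimum: no single-vertex flip is improving. -/
noncomputable def deg (G : SimpleGraph V) (v : V) : ℕ :=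
  (Finset.univ.filter (fun u => G.Adj v u)).card

def IsLocalOpt (G : SimpleGraph V) (X : Sym2 V → ℝ) (σ : V → ℝ) : Prop :=
  ∀ v : V, impr G X σ {v} ≤ 0


open MeasureTheory ProbabilityTheory

/-- The uniform probability measure on the interval `[a, b]`. -/
noncomputable def uniformIcc (a b : ℝ) : Measure ℝ :=
  (volume (Set.Icc a b))⁻¹ • volume.restrict (Set.Icc a b)

/-- Convert a boolean colouring into a `±1`-valued cut. -/
noncomputable def toCut {V : Type*} (f : V → Bool) : V → ℝ := fun v => if f v then 1 else -1

section Work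
open scoped ENNReal

section Abs
variable {U : Type*} [MeasurableSpace U]

/-- one step of the attainable set -/
noncomputable def stepA (W : U → ℝ) (Fr : Set U) (A : Finset ℝ) (u : U) : Finset ℝ :=
  if u ∈ Fr then A.image (fun x => x + W u) ∪ A.image (fun x => x - W u)
  else A.image (fun x => x + W u)

/-- recursive failure bound -/
noncomputable def Fail (ν : Measure U) (W : U → ℝ) (Fr : Set U) (δ : ℝ) : ℕ → Finset ℝ → ℝ≥0∞
  | 0, A => if ∃ a ∈ A, a ∈ Set.Icc (-δ) 0 then 0 else 1
  | n + 1, A => ∫⁻ u, Fail ν W Fr δ n (stepA W Fr A u) ∂ν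

def Hit (W : U → ℝ) (Fr : Set U) (δ : ℝ) {n : ℕ} (A : Finset ℝ) (u : Fin n → U) : Prop :=
  ∃ ε : Fin n → Bool, (∀ i, ε i = true → u i ∈ Fr) ∧
    ∃ a ∈ A, a + ∑ i, (if ε i = true then - W (u i) else W (u i)) ∈ Set.Icc (-δ) 0

lemma measurableSet_hit (W : U → ℝ) (hW : Measurable W) (Fr : Set U) (hFr : MeasurableSet Fr)
    (δ : ℝ) {n : ℕ} (A : Finset ℝ) : MeasurableSet {u : Fin n → U | Hit W Fr δ A u} := by
  have : {u : Fin n → U | Hit W Fr δ A u} = ⋃ ε : Fin n → Bool,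
      ((⋂ i, {u : Fin n → U | ε i = true → u i ∈ Fr}) ∩
      ⋃ a ∈ A, (fun u : Fin n → U => a + ∑ i, (if ε i = true then - W (u i) else W (u i))) ⁻¹'
        Set.Icc (-δ) 0) := by
    ext u
    simp only [Hit, Set.mem_iUnion, Set.mem_inter_iff, Set.mem_iInter, Set.mem_ofPred_eq,
      Set.mem_preimage, exists_prop]
  rw [this]
  refine MeasurableSet.iUnion fun ε => MeasurableSet.inter (MeasurableSet.iInter fun i => ?_) ?_
  · by_cases h : ε i = true
    · simp only [h, true_imp_iff]
      exact (measurable_pi_apply i) hFr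
    · simp [h]
  · refine Finset.measurableSet_biUnion A fun a _ => ?_
    refine measurableSet_preimage (measurable_const.add (Finset.measurable_sum _ fun i _ => ?_))
      measurableSet_Icc
    by_cases h : ε i = true
    · simp only [h, if_true]; exact (hW.comp (measurable_pi_apply i)).neg
    · simp only [h]; exact (hW.comp (measurable_pi_apply i))

lemma hit_cons (W : U → ℝ) (Fr : Set U) (δ : ℝ) {n : ℕ} (A : Finset ℝ) (x : U) (u : Fin n → U)
    (h : Hit W Fr δ (stepA W Fr A x) u) : Hit W Fr δ A (Fin.cons x u : Fin (n+1) → U) := by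
  obtain ⟨ε, h1, a, ha, h2⟩ := h
  by_cases hx : x ∈ Fr
  · simp only [stepA, hx, if_true, Finset.mem_union, Finset.mem_image] at ha
    rcases ha with ⟨a', ha', rfl⟩ | ⟨a', ha', rfl⟩
    · refine ⟨Fin.cons false ε, ?_, a', ha', ?_⟩
      · intro i; refine Fin.cases ?_ (fun i => ?_) i <;> simp; exact h1 i
      · rw [Fin.sum_univ_succ]; simpa [add_assoc] using h2
    · refine ⟨Fin.cons true ε, ?_, a', ha', ?_⟩
      · intro i; refine Fin.cases ?_ (fun i => ?_) i
        · simpa using hx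
        · simpa using h1 i
      · rw [Fin.sum_univ_succ]; simpa [add_assoc, sub_eq_add_neg] using h2
  · simp only [stepA, hx, if_false, Finset.mem_image] at ha
    rcases ha with ⟨a', ha', rfl⟩
    refine ⟨Fin.cons false ε, ?_, a', ha', ?_⟩
    · intro i; refine Fin.cases ?_ (fun i => ?_) i <;> simp; exact h1 i
    · rw [Fin.sum_univ_succ]; simpa [add_assoc] using h2

lemma fail_link (ν : Measure U) [IsProbabilityMeasure ν] (W : U → ℝ) (hW : Measurable W)
    (Fr : Set U) (hFr : MeasurableSet Fr) (δ : ℝ) (n : ℕ) : ∀ A : Finset ℝ,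
    (Measure.pi (fun _ : Fin n => ν)) {u | ¬ Hit W Fr δ A u} ≤ Fail ν W Fr δ n A := by
  induction n with
  | zero =>
    intro A
    rw [Fail]
    split_ifs with h
    · have : {u : Fin 0 → U | ¬ Hit W Fr δ A u} = ∅ := by
        ext u
        simp only [Set.mem_ofPred_eq, Set.mem_empty_iff_false, iff_false, not_not]
        obtain ⟨a, ha, h⟩ := h
        exact ⟨fun _ => false, by simp, a, ha, by simpa using h⟩
      rw [this]; simp
    · exact prob_le_one
  | succ n ih =>
    intro A
    have hm := measurableSet_hit W hW Fr hFr δ (n := n + 1) A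
    have hp := (measurePreserving_piFinSuccAbove (fun _ : Fin (n+1) => ν) 0).symm
    change (Measure.pi _) {u | Hit W Fr δ A u}ᶜ ≤ _
    rw [← hp.measure_preimage hm.compl.nullMeasurableSet,
      Measure.prod_apply (hp.measurable hm.compl), Fail]
    refine lintegral_mono fun x => ?_
    refine le_trans (measure_mono ?_) (ih (stepA W Fr A x))
    intro u hu hh
    apply hu
    have := hit_cons W Fr δ A x u hh
    simpa [MeasurableEquiv.piFinSuccAbove, Fin.insertNthEquiv] using this

lemma fail_le_one (ν : Measure U) [IsProbabilityMeasure ν] (W : U → ℝ) (Fr : Set U) (δ : ℝ)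
    (n : ℕ) : ∀ A, Fail ν W Fr δ n A ≤ 1 := by
  induction n with
  | zero => intro A; rw [Fail]; split_ifs <;> simp
  | succ n ih =>
    intro A; rw [Fail]
    calc _ ≤ ∫⁻ _, 1 ∂ν := lintegral_mono fun u => ih _
      _ = 1 := by simp

/-- bound a lower integral by a Bochner integral -/
lemma lint_le (ν : Measure U) (f : U → ℝ≥0∞) (h : U → ℝ) (hi : Integrable h ν)
    (h0 : ∀ u, 0 ≤ h u) (hf : ∀ᵐ u ∂ν, f u ≤ ENNReal.ofReal (h u)) :
    ∫⁻ u, f u ∂ν ≤ ENNReal.ofReal (∫ u, h u ∂ν) := by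
  rw [ofReal_integral_eq_lintegral_ofReal hi (Filter.Eventually.of_forall h0)]
  exact lintegral_mono_ae hf

def nbd (δ : ℝ) (A : Finset ℝ) : Set ℝ := ⋃ a ∈ A, Set.Icc a (a + δ)

lemma measurableSet_nbd (δ : ℝ) (A : Finset ℝ) : MeasurableSet (nbd δ A) :=
  Finset.measurableSet_biUnion A fun _ _ => measurableSet_Icc

lemma nbd_fin (δ : ℝ) (A : Finset ℝ) : volume (nbd δ A) ≠ ∞ := by
  refine ne_of_lt (lt_of_le_of_lt (measure_biUnion_finset_le A _) ?_)
  simp [Real.volume_Icc, ENNReal.mul_lt_top]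

lemma nbd_add (δ : ℝ) (A : Finset ℝ) (w : ℝ) :
    nbd δ (A.image (fun x => x + w)) = (fun x => x - w) ⁻¹' nbd δ A := by
  ext x
  simp only [nbd, Set.mem_iUnion, Finset.mem_image, Set.mem_preimage, Set.mem_Icc]
  constructor
  · rintro ⟨_, ⟨a, ha, rfl⟩, h1, h2⟩
    exact ⟨a, ha, by linarith, by linarith⟩
  · rintro ⟨a, ha, h1, h2⟩
    exact ⟨a + w, ⟨a, ha, rfl⟩, by linarith, by linarith⟩

lemma nbd_union (δ : ℝ) (A B : Finset ℝ) : nbd δ (A ∪ B) = nbd δ A ∪ nbd δ B := by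
  ext x; simp only [nbd, Set.mem_iUnion, Finset.mem_union, Set.mem_union]
  constructor
  · rintro ⟨a, h | h, h'⟩
    · exact Or.inl ⟨a, h, h'⟩
    · exact Or.inr ⟨a, h, h'⟩
  · rintro (⟨a, h, h'⟩ | ⟨a, h, h'⟩)
    · exact ⟨a, Or.inl h, h'⟩
    · exact ⟨a, Or.inr h, h'⟩

lemma vol_shift (S : Set ℝ) (w : ℝ) : volume ((fun x => x - w) ⁻¹' S) = volume S := by
  simpa [sub_eq_add_neg] using measure_preimage_add_right volume (-w) S

def Dense' (δ θ : ℝ) (A : Finset ℝ) (z : ℝ) : Prop :=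
  θ ≤ volume.real (nbd δ A ∩ Set.Icc (z - 1/16) (z + 1/16))

lemma dense_mono {δ θ : ℝ} {A B : Finset ℝ} {z : ℝ} (h : A ⊆ B) (hd : Dense' δ θ A z) :
    Dense' δ θ B z := by
  refine le_trans hd (measureReal_mono ?_ ?_)
  · refine Set.inter_subset_inter_left _ ?_
    exact Set.biUnion_subset_biUnion_left h
  · exact ne_top_of_le_ne_top (nbd_fin δ B) (measure_mono Set.inter_subset_left)

lemma dense_shift {δ θ : ℝ} {A : Finset ℝ} {z : ℝ} (w : ℝ) (hd : Dense' δ θ A z) :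
    Dense' δ θ (A.image (fun x => x + w)) (z + w) := by
  unfold Dense' at *
  have : nbd δ (A.image (fun x => x + w)) ∩ Set.Icc (z + w - 1/16) (z + w + 1/16)
      = (fun x => x - w) ⁻¹' (nbd δ A ∩ Set.Icc (z - 1/16) (z + 1/16)) := by
    rw [nbd_add]
    ext x
    simp only [Set.mem_inter_iff, Set.mem_preimage, Set.mem_Icc]
    constructor
    · rintro ⟨h1, h2, h3⟩; exact ⟨h1, by linarith, by linarith⟩
    · rintro ⟨h1, h2, h3⟩; exact ⟨h1, by linarith, by linarith⟩
  rw [this]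
  unfold Measure.real at *
  rwa [vol_shift]

lemma dense_step (W : U → ℝ) (Fr : Set U) {δ θ : ℝ} {A : Finset ℝ} {z : ℝ} (u : U)
    (hd : Dense' δ θ A z) : Dense' δ θ (stepA W Fr A u) (z + W u) := by
  refine dense_mono ?_ (dense_shift (W u) hd)
  unfold stepA; split_ifs
  · exact Finset.subset_union_left
  · exact subset_rfl

lemma dense_step' (W : U → ℝ) (Fr : Set U) {δ θ : ℝ} {A : Finset ℝ} {z : ℝ} (u : U)
    (hu : u ∈ Fr) (hd : Dense' δ θ A z) : Dense' δ θ (stepA W Fr A u) (z - W u) := by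
  have := dense_shift (-W u) hd
  rw [← sub_eq_add_neg] at this
  refine dense_mono ?_ this
  unfold stepA; rw [if_pos hu]
  simp only [← sub_eq_add_neg]
  exact Finset.subset_union_right

end Abs

section Abs2
variable {U : Type*} [MeasurableSpace U]

structure Facts (ν : Measure U) (W : U → ℝ) (Fr : Set U) (B c0 : ℝ) : Prop where
  prob : IsProbabilityMeasure ν
  hW : Measurable W
  hFr : MeasurableSet Fr
  hB : 1 ≤ B
  c0pos : 0 < c0
  c0le : c0 ≤ 1
  F1 : ∀ᵐ u ∂ν, |W u| ≤ B
  F2 : ∫ u, W u ∂ν = 0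
  F3a : ∀ u ∈ Fr, |W u| ≤ 1/4
  F3 : ∀ M : Set ℝ, MeasurableSet M → ν (Fr ∩ W ⁻¹' M) ≤ volume M
  F4 : ∀ M : Set ℝ, MeasurableSet M → M ⊆ Set.Icc (-(3/16)) (3/16) →
    ENNReal.ofReal c0 * volume M ≤ ν (Fr ∩ W ⁻¹' M)

lemma Facts.F4r {ν : Measure U} {W : U → ℝ} {Fr : Set U} {B c0 : ℝ} (F : Facts ν W Fr B c0)
    (M : Set ℝ) (hM : MeasurableSet M) (h : M ⊆ Set.Icc (-(3/16)) (3/16)) :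
    c0 * volume.real M ≤ ν.real (Fr ∩ W ⁻¹' M) := by
  have := F.prob
  have h1 := ENNReal.toReal_mono (measure_ne_top _ _) (F.F4 M hM h)
  rw [ENNReal.toReal_mul, ENNReal.toReal_ofReal F.c0pos.le] at h1
  exact h1

lemma lint_ind (ν : Measure U) [IsProbabilityMeasure ν] (f : U → ℝ≥0∞) (G : Set U)
    (hG : MeasurableSet G) (x g : ℝ) (hx0 : 0 ≤ x) (hx1 : x ≤ 1) (hg : g ≤ ν.real G)
    (h1 : ∀ u, f u ≤ 1) (h2 : ∀ u ∈ G, f u ≤ ENNReal.ofReal (1 - x)) :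
    ∫⁻ u, f u ∂ν ≤ ENNReal.ofReal (1 - x * g) := by
  refine le_trans (lint_le ν f (fun u => 1 - G.indicator (fun _ => x) u) ?_ ?_ ?_) ?_
  · exact (integrable_const _).sub ((integrable_const _).indicator hG)
  · intro u
    by_cases h : u ∈ G <;> simp [h, hx1]
  · refine Filter.Eventually.of_forall fun u => ?_
    by_cases h : u ∈ G
    · simpa [h] using h2 u h
    · simpa [h] using h1 u
  · apply ENNReal.ofReal_le_ofReal
    rw [integral_sub (integrable_const _) ((integrable_const _).indicator hG),
      integral_indicator_const _ hG]
    simp only [integral_const, probReal_univ, smul_eq_mul]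
    nlinarith

lemma box_base {ν : Measure U} {W : U → ℝ} {Fr : Set U} {B c0 : ℝ} (F : Facts ν W Fr B c0)
    {δ θ : ℝ} (A : Finset ℝ) (z : ℝ) (hz : |z| ≤ 1/8)
    (hd : Dense' δ θ A z) : Fail ν W Fr δ 1 A ≤ ENNReal.ofReal (1 - c0 * θ) := by
  have := F.prob
  rw [Fail]
  set M := nbd δ A ∩ Set.Icc (z - 1/16) (z + 1/16) with hM
  have hMm : MeasurableSet M := (measurableSet_nbd δ A).inter measurableSet_Icc
  have hMs : M ⊆ Set.Icc (-(3/16)) (3/16) := by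
    rintro y ⟨-, h1, h2⟩
    rw [abs_le] at hz
    constructor <;> linarith
  have hg : c0 * θ ≤ ν.real (Fr ∩ W ⁻¹' M) :=
    le_trans (mul_le_mul_of_nonneg_left hd F.c0pos.le) (F.F4r M hMm hMs)
  have := lint_ind ν (fun u => Fail ν W Fr δ 0 (stepA W Fr A u)) (Fr ∩ W ⁻¹' M)
    (F.hFr.inter (F.hW hMm)) 1 (c0 * θ) (by norm_num) le_rfl hg
    (fun u => fail_le_one ν W Fr δ 0 _) ?_
  · simpa using this
  · rintro u ⟨hu, h, -⟩
    rw [Fail, if_pos]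
    · simp
    · simp only [nbd, Set.mem_iUnion, Set.mem_Icc] at h
      obtain ⟨a, ha, h1, h2⟩ := h
      refine ⟨a - W u, ?_, by constructor <;> linarith⟩
      simp only [stepA, hu, if_true, Finset.mem_union, Finset.mem_image]
      exact Or.inr ⟨a, ha, rfl⟩

lemma box {ν : Measure U} {W : U → ℝ} {Fr : Set U} {B c0 : ℝ} (F : Facts ν W Fr B c0)
    {δ θ : ℝ} (hθ0 : 0 ≤ θ) (hθ : θ ≤ 1/16) (j : ℕ) : ∀ (A : Finset ℝ) (z : ℝ),
    |z| ≤ (j + 2) / 16 → Dense' δ θ A z →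
    Fail ν W Fr δ (j + 1) A ≤ ENNReal.ofReal (1 - (c0 * θ) ^ (j + 1)) := by
  have := F.prob
  have hc := F.c0pos
  have hc1 := F.c0le
  have hcθ : 0 ≤ c0 * θ := by positivity
  have hcθ1 : c0 * θ ≤ 1 := by nlinarith
  induction j with
  | zero =>
    intro A z hz hd
    simpa using box_base F A z (by norm_num at hz ⊢; linarith) hd
  | succ j ih =>
    intro A z hz hd
    rw [Fail]
    have hS : Set.Icc (1/16 : ℝ) (1/8) ⊆ Set.Icc (-(3/16)) (3/16) :=
      Set.Icc_subset_Icc (by norm_num) (by norm_num)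
    have hg := F.F4r _ measurableSet_Icc hS
    have hv : volume.real (Set.Icc (1/16 : ℝ) (1/8)) = 1/16 := by
      rw [Real.volume_real_Icc]; norm_num
    rw [hv] at hg
    have hg' : c0 * θ ≤ ν.real (Fr ∩ W ⁻¹' (Set.Icc (1/16 : ℝ) (1/8))) :=
      le_trans (mul_le_mul_of_nonneg_left hθ hc.le) hg
    have := lint_ind ν (fun u => Fail ν W Fr δ (j+1) (stepA W Fr A u)) _
      (F.hFr.inter (F.hW measurableSet_Icc)) ((c0 * θ) ^ (j + 1)) (c0 * θ) (by positivity)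
      (pow_le_one₀ hcθ hcθ1) hg' (fun u => fail_le_one ν W Fr δ _ _) ?_
    · rw [pow_succ]; exact this
    · rintro u ⟨hu, h1, h2⟩
      push_cast at hz
      have hj : (0:ℝ) ≤ j := by positivity
      rw [abs_le] at hz
      rcases le_or_gt 0 z with h | h
      · refine ih _ (z - W u) ?_ (dense_step' W Fr u hu hd)
        rw [abs_le]; constructor <;> linarith
      · refine ih _ (z + W u) ?_ (dense_step W Fr u hd)
        rw [abs_le]; constructor <;> linarith

/-- next cell centre -/
noncomputable def zn (W : U → ℝ) (Fr : Set U) (s z : ℝ) (u : U) : ℝ :=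
  if u ∈ Fr ∩ {u | 0 ≤ s * W u} then z - W u else z + W u

lemma dense_zn (W : U → ℝ) (Fr : Set U) {δ θ : ℝ} {A : Finset ℝ} {z : ℝ} (s : ℝ) (u : U)
    (hd : Dense' δ θ A z) : Dense' δ θ (stepA W Fr A u) (zn W Fr s z u) := by
  unfold zn
  split_ifs with h
  · exact dense_step' W Fr u h.1 hd
  · exact dense_step W Fr u hd

lemma measurable_zn {ν : Measure U} {W : U → ℝ} {Fr : Set U} {B c0 : ℝ} (F : Facts ν W Fr B c0)
    (s z : ℝ) : Measurable (zn W Fr s z) := by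
  have h1 := F.hW
  refine Measurable.ite ?_ (by fun_prop) (by fun_prop)
  exact F.hFr.inter (measurableSet_le measurable_const (h1.const_mul s))

lemma zn_bd (W : U → ℝ) (Fr : Set U) (s z : ℝ) (u : U) (B : ℝ) (h : |W u| ≤ B) :
    |zn W Fr s z u| ≤ |z| + B := by
  unfold zn
  split_ifs
  · exact (abs_sub _ _).trans (by linarith)
  · exact (abs_add_le _ _).trans (by linarith)

lemma integrable_V {ν : Measure U} {W : U → ℝ} {Fr : Set U} {B c0 : ℝ} (F : Facts ν W Fr B c0)
    (s z l : ℝ) (hl : 0 ≤ l) : Integrable (fun u => Real.exp (l * |zn W Fr s z u|)) ν := by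
  have := F.prob
  have hm := measurable_zn F s z
  refine Integrable.of_bound (C := Real.exp (l * (|z| + B))) ?_ ?_
  · have : Measurable fun u => Real.exp (l * |zn W Fr s z u|) :=
      Real.measurable_exp.comp ((measurable_norm.comp hm).const_mul l)
    exact this.aestronglyMeasurable
  · filter_upwards [F.F1] with u hu
    rw [Real.norm_eq_abs, Real.abs_exp]
    apply Real.exp_le_exp.2
    exact mul_le_mul_of_nonneg_left (zn_bd W Fr s z u B hu) hl

lemma lyap_step {ν : Measure U} {W : U → ℝ} {Fr : Set U} {B c0 : ℝ} (F : Facts ν W Fr B c0)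
    (l : ℝ) (hl : l = c0 / 256 / B ^ 2) (z : ℝ) : ∃ s : ℝ,
    ∫ u, Real.exp (l * |zn W Fr s z u|) ∂ν ≤
      (1 - l * (c0 / 256)) * Real.exp (l * |z|) + Real.exp (2 * l * B) := by
  have := F.prob
  have hB := F.hB
  have hc := F.c0pos
  have hc1 := F.c0le
  have hl0 : 0 < l := by rw [hl]; positivity
  have hlB2 : l * B ^ 2 = c0 / 256 := by rw [hl]; field_simp
  have hlB : l * B ≤ 1 := by nlinarith
  have hll : l ≤ 1 := by nlinarith
  have hρ : 0 ≤ 1 - l * (c0/256) := by nlinarith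
  rcases lt_or_ge (|z|) B with hz | hz
  · refine ⟨1, ?_⟩
    calc ∫ u, Real.exp (l * |zn W Fr 1 z u|) ∂ν ≤ ∫ u, Real.exp (2 * l * B) ∂ν := by
          refine integral_mono_ae (integrable_V F _ _ _ hl0.le) (integrable_const _) ?_
          filter_upwards [F.F1] with u hu
          apply Real.exp_le_exp.2
          have := zn_bd W Fr 1 z u B hu
          nlinarith
      _ = Real.exp (2 * l * B) := by simp
      _ ≤ _ := by
          have := mul_nonneg hρ (Real.exp_pos (l * |z|)).le
          linarith
  · obtain ⟨s, hs, hsz⟩ : ∃ s : ℝ, (s = 1 ∨ s = -1) ∧ s * z = |z| := by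
      rcases le_or_gt 0 z with h | h
      · exact ⟨1, Or.inl rfl, by rw [abs_of_nonneg h]; ring⟩
      · exact ⟨-1, Or.inr rfl, by rw [abs_of_neg h]; ring⟩
    refine ⟨s, ?_⟩
    have hss : s * s = 1 := by rcases hs with rfl | rfl <;> norm_num
    have hsa : ∀ x : ℝ, |s * x| = |x| := by
      intro x; rcases hs with rfl | rfl <;> simp
    set M : Set ℝ := (fun x => s * x) ⁻¹' Set.Icc (1/16) (1/8) with hMd
    have hMm : MeasurableSet M := (measurable_const_mul s) measurableSet_Icc
    have hMs : M ⊆ Set.Icc (-(3/16)) (3/16) := by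
      rintro x ⟨h1, h2⟩
      simp only at h1 h2
      rcases hs with rfl | rfl <;> constructor <;> linarith
    have hv : volume.real M = 1/16 := by
      rw [hMd, Measure.real, Real.volume_preimage_mul_left (by rcases hs with rfl | rfl <;> norm_num)]
      rw [Real.volume_Icc]
      rcases hs with rfl | rfl <;> · norm_num
    have hg := F.F4r M hMm hMs
    rw [hv] at hg
    set G := Fr ∩ W ⁻¹' M with hG
    have hGm : MeasurableSet G := F.hFr.inter (F.hW hMm)
    have hWi : Integrable W ν := Integrable.of_bound F.hW.aestronglyMeasurable B F.F1
    have hpt : ∀ᵐ u ∂ν, Real.exp (l * |zn W Fr s z u|) ≤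
        Real.exp (l * |z|) * ((1 + l ^ 2 * B ^ 2) + (l * s) * W u - G.indicator (fun _ => l / 8) u) := by
      filter_upwards [F.F1] with u hu
      obtain ⟨y, hy, hyB, hy2⟩ : ∃ y, |zn W Fr s z u| = |z| + y ∧ |y| ≤ B ∧
          y ≤ s * W u - G.indicator (fun _ => (1:ℝ) / 8) u := by
        have hsz' : ∀ x : ℝ, |x| ≤ B → |z + x| = |z| + s * x := by
          intro x hx
          rw [← hsa (z + x), mul_add, hsz, abs_of_nonneg]
          have := neg_abs_le (s * x)
          rw [hsa] at this
          linarith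
        unfold zn
        split_ifs with h
        · have hneg : |(-W u)| ≤ B := by rwa [abs_neg]
          refine ⟨s * (-W u), by rw [sub_eq_add_neg]; exact hsz' _ hneg, by rw [hsa]; exact hneg, ?_⟩
          have h0 : 0 ≤ s * W u := h.2
          by_cases hu : u ∈ G
          · have : (1/16 : ℝ) ≤ s * W u := hu.2.1
            simp only [hu, Set.indicator_of_mem]; linarith
          · simp only [hu, not_false_eq_true, Set.indicator_of_notMem]; linarith
        · refine ⟨s * W u, hsz' _ hu, by rw [hsa]; exact hu, ?_⟩
          have : u ∉ G := by
            intro hu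
            apply h
            refine ⟨hu.1, ?_⟩
            have : (1/16 : ℝ) ≤ s * W u := hu.2.1
            change 0 ≤ s * W u
            linarith
          simp [this]
      rw [hy, mul_add, Real.exp_add]
      refine mul_le_mul_of_nonneg_left ?_ (Real.exp_pos _).le
      have hly : |l * y| ≤ 1 := by
        rw [abs_mul, abs_of_pos hl0]; nlinarith
      have h1 := (abs_le.1 (Real.abs_exp_sub_one_sub_id_le hly)).2
      have h2 : (l * y) ^ 2 ≤ l ^ 2 * B ^ 2 := by
        rw [mul_pow]
        refine mul_le_mul_of_nonneg_left ?_ (by positivity)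
        rw [← sq_abs]; exact pow_le_pow_left₀ (abs_nonneg _) hyB 2
      have h3 : G.indicator (fun _ => l / 8) u = l * G.indicator (fun _ => (1:ℝ) / 8) u := by
        by_cases hu : u ∈ G <;> simp [hu]; ring
      rw [h3]
      have := mul_le_mul_of_nonneg_left hy2 hl0.le
      linarith
    have hi1 : Integrable (fun u => (1 + l ^ 2 * B ^ 2) + (l * s) * W u) ν :=
      (integrable_const _).add (hWi.const_mul _)
    have hi2 : Integrable (G.indicator (fun _ => l / 8)) ν := (integrable_const _).indicator hGm
    calc _ ≤ ∫ u, Real.exp (l * |z|) * ((1 + l ^ 2 * B ^ 2) + (l * s) * W u -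
            G.indicator (fun _ => l / 8) u) ∂ν :=
          integral_mono_ae (integrable_V F _ _ _ hl0.le) ((hi1.sub hi2).const_mul _) hpt
      _ = Real.exp (l * |z|) * (1 + l ^ 2 * B ^ 2 - ν.real G * (l / 8)) := by
          rw [integral_const_mul, integral_sub hi1 hi2, integral_indicator_const _ hGm,
            integral_add (integrable_const _) (hWi.const_mul _), integral_const_mul, F.F2]
          simp
      _ ≤ Real.exp (l * |z|) * (1 - l * (c0/256)) := by
          refine mul_le_mul_of_nonneg_left ?_ (Real.exp_pos _).le
          have h1 : l ^ 2 * B ^ 2 = l * (c0 / 256) := by rw [← hlB2]; ring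
          have h2 := mul_le_mul_of_nonneg_left hg (show 0 ≤ l / 8 by positivity)
          rw [h1]
          linarith
      _ ≤ _ := by
          have := Real.exp_pos (2 * l * B)
          linarith

end Abs2

section Abs3
variable {U : Type*} [MeasurableSpace U]

lemma lyap {ν : Measure U} {W : U → ℝ} {Fr : Set U} {B c0 : ℝ} (F : Facts ν W Fr B c0)
    {θ : ℝ} (hθ0 : 0 < θ) (hθ : θ ≤ 1/16) :
    ∃ (h : ℕ) (c1 l ρ : ℝ), 0 < c1 ∧ c1 ≤ 1 ∧ 0 ≤ l ∧ 0 ≤ ρ ∧ ρ < 1 ∧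
      ∀ (δ : ℝ) (r : ℕ) (A : Finset ℝ) (z : ℝ), Dense' δ θ A z →
        Fail ν W Fr δ (h + r) A ≤
          ENNReal.ofReal (1 - 3 * c1 / 4 + ρ ^ r * Real.exp (l * |z|)) := by
  have := F.prob
  have hB := F.hB
  have hc := F.c0pos
  have hc1 := F.c0le
  obtain ⟨l, hl⟩ : ∃ l, l = c0 / 256 / B ^ 2 := ⟨_, rfl⟩
  have hl0 : 0 < l := by rw [hl]; positivity
  have hlB2 : l * B ^ 2 = c0 / 256 := by rw [hl]; field_simp
  have hll : l ≤ 1 := by nlinarith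
  set ρ := 1 - l * (c0 / 256) with hρd
  have hρ : 0 ≤ ρ := by rw [hρd]; nlinarith
  have hρ1 : 0 < 1 - ρ := by rw [hρd]; ring_nf; positivity
  set b0 := Real.exp (2 * l * B) with hb0
  have hb0p : 0 < b0 := Real.exp_pos _
  set b2 := b0 / (1 - ρ) with hb2
  have hb2p : 0 < b2 := by positivity
  have hbb : b2 * (1 - ρ) = b0 := by rw [hb2]; field_simp
  obtain ⟨j, hj⟩ := exists_nat_ge (4 * b2 * 16 / l)
  set K : ℝ := (j + 2) / 16 with hK
  have hKb : 4 * b2 ≤ Real.exp (l * K) := by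
    have h1 := Real.add_one_le_exp (l * K)
    rw [div_le_iff₀ hl0] at hj
    rw [hK] at h1 ⊢
    nlinarith
  set c1 := (c0 * θ) ^ (j + 1) with hcc
  have hcθ : 0 < c0 * θ := by positivity
  have hcθ1 : c0 * θ ≤ 1 := by nlinarith
  have hc1p : 0 < c1 := by positivity
  have hc1l : c1 ≤ 1 := pow_le_one₀ hcθ.le hcθ1
  have hKp := Real.exp_pos (l * K)
  set κ := c1 / Real.exp (l * K) with hκ
  have hκp : 0 < κ := by positivity
  have hκK : κ * Real.exp (l * K) = c1 := by rw [hκ]; field_simp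
  have hKge : 0 ≤ K := by rw [hK]; positivity
  have hexp1 : 1 ≤ Real.exp (l * K) := Real.one_le_exp (by positivity)
  have hκ1 : κ ≤ 1 := by nlinarith
  have main : ∀ (δ : ℝ) (r : ℕ) (A : Finset ℝ) (z : ℝ), Dense' δ θ A z →
        Fail ν W Fr δ (j + 1 + r) A ≤
          ENNReal.ofReal (1 - c1 + κ * (ρ ^ r * (Real.exp (l * |z|) - b2) + b2)) := by
    intro δ r
    induction r with
    | zero =>
      intro A z hd
      have hV := Real.exp_pos (l * |z|)
      rcases le_or_gt (|z|) K with hz | hz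
      · refine le_trans (box F hθ0.le hθ j A z hz hd) (ENNReal.ofReal_le_ofReal ?_)
        have : 0 ≤ κ * (Real.exp (l * |z|)) := by positivity
        simp only [pow_zero, one_mul]
        linarith
      · refine le_trans (fail_le_one ν W Fr δ _ A) ?_
        rw [← ENNReal.ofReal_one]
        apply ENNReal.ofReal_le_ofReal
        have h1 : Real.exp (l * K) ≤ Real.exp (l * |z|) :=
          Real.exp_le_exp.2 (mul_le_mul_of_nonneg_left hz.le hl0.le)
        have := mul_le_mul_of_nonneg_left h1 hκp.le
        simp only [pow_zero, one_mul]
        linarith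
    | succ r ih =>
      intro A z hd
      obtain ⟨s, hs⟩ := lyap_step F l hl z
      rw [← hρd, ← hb0] at hs
      rw [← add_assoc, Fail]
      have hi := integrable_V F s z l hl0.le
      have hr1 : ρ ^ r ≤ 1 := pow_le_one₀ hρ (by linarith)
      have hr0 : 0 ≤ ρ ^ r := by positivity
      have hi' : Integrable (fun u => 1 - c1 + κ * (ρ ^ r *
          (Real.exp (l * |zn W Fr s z u|) - b2) + b2)) ν := by
        refine (integrable_const _).add (Integrable.const_mul ?_ _)
        exact ((hi.sub (integrable_const _)).const_mul _).add (integrable_const _)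
      refine le_trans (lint_le ν _ _ hi' ?_
        (Filter.Eventually.of_forall fun u => ih _ _ (dense_zn W Fr s u hd))) ?_
      · intro u
        have hV := Real.exp_pos (l * |zn W Fr s z u|)
        have h2 : 0 ≤ ρ ^ r * (Real.exp (l * |zn W Fr s z u|) - b2) + b2 := by nlinarith
        have := mul_nonneg hκp.le h2
        linarith
      · apply ENNReal.ofReal_le_ofReal
        have hfun : ∫ u, (1 - c1 + κ * (ρ ^ r * (Real.exp (l * |zn W Fr s z u|) - b2) + b2)) ∂ν =
            (1 - c1 + κ * (b2 - ρ ^ r * b2)) +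
              (κ * ρ ^ r) * ∫ u, Real.exp (l * |zn W Fr s z u|) ∂ν := by
          have : ∀ u, (1 - c1 + κ * (ρ ^ r * (Real.exp (l * |zn W Fr s z u|) - b2) + b2)) =
            (1 - c1 + κ * (b2 - ρ ^ r * b2)) + (κ * ρ ^ r) * Real.exp (l * |zn W Fr s z u|) := by
            intro u; ring
          simp_rw [this]
          rw [integral_add (integrable_const _) (hi.const_mul _), integral_const_mul]
          simp
        rw [hfun]
        have h3 : ρ ^ r * (∫ u, Real.exp (l * |zn W Fr s z u|) ∂ν - b2) ≤
            ρ ^ r * (ρ * (Real.exp (l * |z|) - b2)) := by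
          refine mul_le_mul_of_nonneg_left ?_ hr0
          linarith
        rw [pow_succ, mul_assoc]
        have := mul_le_mul_of_nonneg_left (add_le_add_left h3 b2) hκp.le
        linarith
  refine ⟨j + 1, c1, l, ρ, hc1p, hc1l, hl0.le, hρ, by linarith, ?_⟩
  intro δ r A z hd
  refine le_trans (main δ r A z hd) (ENNReal.ofReal_le_ofReal ?_)
  have hr0 : 0 ≤ ρ ^ r := by positivity
  have hV := Real.exp_pos (l * |z|)
  have h1 : κ * b2 ≤ c1 / 4 := by
    have := mul_le_mul_of_nonneg_left hKb hκp.le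
    linarith
  have h2 : κ * (ρ ^ r * Real.exp (l * |z|)) ≤ ρ ^ r * Real.exp (l * |z|) :=
    mul_le_of_le_one_left (by positivity) hκ1
  have h3 : 0 ≤ κ * (ρ ^ r * b2) := by positivity
  have h4 : κ * (ρ ^ r * (Real.exp (l * |z|) - b2) + b2) =
    κ * (ρ ^ r * Real.exp (l * |z|)) - κ * (ρ ^ r * b2) + κ * b2 := by ring
  rw [h4]
  linarith

lemma window {δ θ : ℝ} (A : Finset ℝ) (h : ∀ z, ¬ Dense' δ θ A z) (y : ℝ) :
    volume (nbd δ A ∩ Set.Icc (y - 1/2) (y + 1/2)) ≤ ENNReal.ofReal (8 * θ) := by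
  have hsub : nbd δ A ∩ Set.Icc (y - 1/2) (y + 1/2) ⊆ ⋃ i ∈ Finset.range 8,
      (nbd δ A ∩ Set.Icc ((y - 7/16 + (i:ℕ) / 8) - 1/16) ((y - 7/16 + (i:ℕ) / 8) + 1/16)) := by
    rintro x ⟨hx, h1, h2⟩
    simp only [Set.mem_iUnion]
    have hex : ∃ i ∈ Finset.range 8, x ∈ Set.Icc ((y - 7/16 + (i:ℕ) / 8) - 1/16)
        ((y - 7/16 + (i:ℕ) / 8) + 1/16) := by
      by_contra hcon
      push Not at hcon
      have h0 := hcon 0 (by simp)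
      have e1 := hcon 1 (by simp)
      have e2 := hcon 2 (by simp)
      have e3 := hcon 3 (by simp)
      have e4 := hcon 4 (by simp)
      have e5 := hcon 5 (by simp)
      have e6 := hcon 6 (by simp)
      have e7 := hcon 7 (by simp)
      simp only [Set.mem_Icc, not_and, not_le] at h0 e1 e2 e3 e4 e5 e6 e7
      norm_num at h0 e1 e2 e3 e4 e5 e6 e7
      have g0 := h0 (by linarith)
      have g1 := e1 (by linarith)
      have g2 := e2 (by linarith)
      have g3 := e3 (by linarith)
      have g4 := e4 (by linarith)
      have g5 := e5 (by linarith)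
      have g6 := e6 (by linarith)
      have g7 := e7 (by linarith)
      linarith
    obtain ⟨i, hi, hxi⟩ := hex
    exact ⟨i, hi, hx, hxi⟩
  refine (measure_mono hsub).trans ((measure_biUnion_finset_le _ _).trans ?_)
  have : ∀ i ∈ Finset.range 8, volume (nbd δ A ∩ Set.Icc ((y - 7/16 + (i:ℕ) / 8) - 1/16)
      ((y - 7/16 + (i:ℕ) / 8) + 1/16)) ≤ ENNReal.ofReal θ := by
    intro i _
    have h1 := h (y - 7/16 + (i:ℕ) / 8)
    unfold Dense' at h1
    push Not at h1
    refine ENNReal.le_ofReal_iff_toReal_le ?_ ?_ |>.2 h1.le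
    · exact ne_top_of_le_ne_top (nbd_fin δ A) (measure_mono Set.inter_subset_left)
    · exact le_trans measureReal_nonneg h1.le
  refine (Finset.sum_le_sum this).trans ?_
  have h8 : ENNReal.ofReal (8 * θ) = 8 * ENNReal.ofReal θ := by
    rw [ENNReal.ofReal_mul (by norm_num)]; norm_num
  rw [h8]; simp

/-- overlap set -/
def ovS (W : U → ℝ) (Fr : Set U) (N : Set ℝ) : Set (U × ℝ) :=
  {p | p.1 ∈ Fr ∧ p.2 ∈ N ∧ p.2 + 2 * W p.1 ∈ N}

lemma measurableSet_ovS {W : U → ℝ} (hW : Measurable W) {Fr : Set U} (hFr : MeasurableSet Fr)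
    {N : Set ℝ} (hN : MeasurableSet N) : MeasurableSet (ovS W Fr N) := by
  refine (measurable_fst hFr).inter ((measurable_snd hN).inter ?_)
  have : Measurable fun p : U × ℝ => p.2 + 2 * W p.1 :=
    measurable_snd.add ((hW.comp measurable_fst).const_mul 2)
  exact this hN

lemma ov_bound {ν : Measure U} {W : U → ℝ} {Fr : Set U} {B c0 : ℝ} (F : Facts ν W Fr B c0)
    {δ θ : ℝ} (A : Finset ℝ) (h : ∀ z, ¬ Dense' δ θ A z) :
    ∫⁻ u, volume (Prod.mk u ⁻¹' ovS W Fr (nbd δ A)) ∂ν ≤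
      ENNReal.ofReal (4 * θ) * volume (nbd δ A) := by
  have := F.prob
  have hm := measurableSet_ovS F.hW F.hFr (measurableSet_nbd δ A)
  rw [← Measure.prod_apply hm, Measure.prod_apply_symm hm]
  have : ∀ y, ν ((fun x => (x, y)) ⁻¹' ovS W Fr (nbd δ A)) ≤
      (nbd δ A).indicator (fun _ => ENNReal.ofReal (4 * θ)) y := by
    intro y
    by_cases hy : y ∈ nbd δ A
    · simp only [hy, Set.indicator_of_mem]
      set T := nbd δ A ∩ Set.Icc (y - 1/2) (y + 1/2) with hT
      have hTm : MeasurableSet T := (measurableSet_nbd δ A).inter measurableSet_Icc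
      have hsub : (fun x => (x, y)) ⁻¹' ovS W Fr (nbd δ A) ⊆
          Fr ∩ W ⁻¹' ((fun w => 2 * w) ⁻¹' ((fun x => y + x) ⁻¹' T)) := by
        rintro u ⟨h1, h2, h3⟩
        refine ⟨h1, h3, ?_⟩
        have := abs_le.1 (F.F3a u h1)
        constructor <;> simp only <;> linarith
      refine (measure_mono hsub).trans ((F.F3 _ ?_).trans ?_)
      · exact (measurable_const_mul (2:ℝ)) ((measurable_const_add y) hTm)
      · rw [Real.volume_preimage_mul_left (by norm_num), measure_preimage_add]
        calc _ ≤ ENNReal.ofReal |(2:ℝ)⁻¹| * ENNReal.ofReal (8 * θ) := by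
              gcongr; exact window A h y
          _ = _ := by
              rw [← ENNReal.ofReal_mul (by positivity)]
              congr 1
              rw [abs_of_pos (by norm_num)]; ring
    · have : (fun x => (x, y)) ⁻¹' ovS W Fr (nbd δ A) = ∅ := by
        ext u
        simp only [Set.mem_preimage, ovS, Set.mem_ofPred_eq, Set.mem_empty_iff_false, iff_false]
        exact fun h => hy h.2.1
      rw [this]; simp
  refine (lintegral_mono this).trans ?_
  rw [lintegral_indicator_const (measurableSet_nbd δ A)]

lemma vol_step (W : U → ℝ) (Fr : Set U) (δ : ℝ) (A : Finset ℝ) (u : U)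
    (hμ : 0 < volume.real (nbd δ A)) :
    0 < volume.real (nbd δ (stepA W Fr A u)) ∧
    1 / volume.real (nbd δ (stepA W Fr A u)) ≤ 1 / volume.real (nbd δ A) *
      (1 - Fr.indicator (fun _ => (1:ℝ) / 2) u +
        volume.real (Prod.mk u ⁻¹' ovS W Fr (nbd δ A)) / (2 * volume.real (nbd δ A))) := by
  set N := nbd δ A with hN
  have hNm : MeasurableSet N := measurableSet_nbd δ A
  by_cases hu : u ∈ Fr
  · have e1 : nbd δ (stepA W Fr A u) =
        ((fun x => x - W u) ⁻¹' N) ∪ ((fun x => x - (-W u)) ⁻¹' N) := by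
      unfold stepA
      rw [if_pos hu, nbd_union, nbd_add]
      simp only [sub_eq_add_neg]
      rw [nbd_add]
      simp only [sub_eq_add_neg]; rfl
    have e2 : ((fun x => x - W u) ⁻¹' N) ∩ ((fun x => x - (-W u)) ⁻¹' N) =
        (fun x => x - W u) ⁻¹' (Prod.mk u ⁻¹' ovS W Fr N) := by
      ext x
      simp only [Set.mem_inter_iff, Set.mem_preimage, ovS, Set.mem_ofPred_eq, hu, true_and]
      have : x - W u + 2 * W u = x - -W u := by ring
      rw [this]
    have e3 := measureReal_union_add_inter (μ := volume) (s := (fun x => x - W u) ⁻¹' N)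
      (t := (fun x => x - (-W u)) ⁻¹' N) (measurable_id.sub_const _ hNm)
      (by rw [vol_shift]; exact nbd_fin δ A) (by rw [vol_shift]; exact nbd_fin δ A)
    rw [← e1, e2] at e3
    unfold Measure.real at e3
    rw [vol_shift, vol_shift, vol_shift] at e3
    change volume.real _ + volume.real _ = volume.real N + volume.real N at e3
    have h4 : volume.real (Prod.mk u ⁻¹' ovS W Fr N) ≤ volume.real N :=
      measureReal_mono (fun y hy => hy.2.1) (nbd_fin δ A)
    have h5 : 0 ≤ volume.real (Prod.mk u ⁻¹' ovS W Fr N) := measureReal_nonneg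
    set m := volume.real N
    set o := volume.real (Prod.mk u ⁻¹' ovS W Fr N)
    set m' := volume.real (nbd δ (stepA W Fr A u))
    have hm' : m' = 2 * m - o := by linarith
    have hp : 0 < m' := by linarith
    refine ⟨hp, ?_⟩
    simp only [hu, Set.indicator_of_mem]
    have : 1 / m * (1 - 1/2 + o / (2 * m)) = (m + o) / (2 * m ^ 2) := by field_simp; ring
    rw [this, div_le_div_iff₀ hp (by positivity), hm']
    nlinarith [mul_nonneg h5 (sub_nonneg.2 h4)]
  · have e1 : volume.real (nbd δ (stepA W Fr A u)) = volume.real N := by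
      unfold stepA
      rw [if_neg hu, nbd_add]
      unfold Measure.real
      rw [vol_shift]
    rw [e1]
    refine ⟨hμ, ?_⟩
    simp only [hu, not_false_eq_true, Set.indicator_of_notMem, sub_zero]
    have h5 : 0 ≤ volume.real (Prod.mk u ⁻¹' ovS W Fr N) := measureReal_nonneg
    have : 0 ≤ volume.real (Prod.mk u ⁻¹' ovS W Fr N) / (2 * volume.real N) := by positivity
    have h6 : 0 < 1 / volume.real N := by positivity
    nlinarith

end Abs3

section Abs4
variable {U : Type*} [MeasurableSpace U]

lemma le_vol_nbd {δ : ℝ} (hδ : 0 < δ) {A : Finset ℝ} (hA : A.Nonempty) :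
    δ ≤ volume.real (nbd δ A) := by
  obtain ⟨a, ha⟩ := hA
  have h1 : volume.real (Set.Icc a (a + δ)) = δ := by
    rw [Real.volume_real_Icc]; simp [hδ.le]
  refine h1.symm.le.trans ?_
  refine measureReal_mono ?_ (nbd_fin δ A)
  exact Set.subset_biUnion_of_mem (u := fun a => Set.Icc a (a + δ)) ha

lemma nbd_sub {δ L : ℝ} (hδ1 : δ ≤ 1) {A : Finset ℝ} (hL : ∀ a ∈ A, |a| ≤ L) :
    nbd δ A ⊆ Set.Icc (-L) (L + 1) := by
  intro x hx
  simp only [nbd, Set.mem_iUnion, Set.mem_Icc] at hx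
  obtain ⟨a, ha, h1, h2⟩ := hx
  have := abs_le.1 (hL a ha)
  constructor <;> linarith

lemma growth {ν : Measure U} {W : U → ℝ} {Fr : Set U} {B c0 : ℝ} (F : Facts ν W Fr B c0)
    {δ L Ψ : ℝ} (hδ : 0 < δ) (hδ1 : δ ≤ 1) (hΨ : 0 ≤ Ψ) (m : ℕ)
    (hD : ∀ n A z, |z| ≤ L + 2 → Dense' δ (3 * c0 / 64) A z →
      Fail ν W Fr δ (n + m) A ≤ ENNReal.ofReal Ψ) (n : ℕ) :
    ∀ A : Finset ℝ, A.Nonempty → (∀ a ∈ A, |a| ≤ L - n * B) →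
      Fail ν W Fr δ (n + m) A ≤
        ENNReal.ofReal (Ψ + (1 - 3 * c0 / 32) ^ n * (2 * L + 2) * (1 / volume.real (nbd δ A))) := by
  have := F.prob
  have hB := F.hB
  have hc := F.c0pos
  have hc1 := F.c0le
  have hγ : 0 ≤ 1 - 3 * c0 / 32 := by linarith
  induction n with
  | zero =>
    intro A hA hL
    have hL' : ∀ a ∈ A, |a| ≤ L := fun a ha => by simpa using hL a ha
    have hL0 : 0 ≤ L := by
      obtain ⟨a, ha⟩ := hA
      exact (abs_nonneg a).trans (hL' a ha)
    refine le_trans (fail_le_one ν W Fr δ _ A) ?_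
    rw [← ENNReal.ofReal_one]
    apply ENNReal.ofReal_le_ofReal
    have h1 : volume.real (nbd δ A) ≤ 2 * L + 1 := by
      refine (measureReal_mono (nbd_sub hδ1 hL') (by simp)).trans ?_
      rw [Real.volume_real_Icc, max_eq_left] <;> linarith
    have h2 := lt_of_lt_of_le hδ (le_vol_nbd hδ hA)
    have h3 : 1 ≤ (2 * L + 2) * (1 / volume.real (nbd δ A)) := by
      rw [mul_one_div, le_div_iff₀ h2]; linarith
    simp only [pow_zero, one_mul]
    linarith
  | succ n ih =>
    intro A hA hL
    have hμ := lt_of_lt_of_le hδ (le_vol_nbd hδ hA)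
    have hn : (0:ℝ) ≤ n := by positivity
    have hL' : ∀ a ∈ A, |a| ≤ L := fun a ha => by
      have := hL a ha
      push_cast at this
      nlinarith
    have hL0 : 0 ≤ L := by
      obtain ⟨a, ha⟩ := hA
      exact (abs_nonneg a).trans (hL' a ha)
    by_cases hd : ∃ z, Dense' δ (3 * c0 / 64) A z
    · obtain ⟨z, hd⟩ := hd
      have hz : |z| ≤ L + 2 := by
        by_contra hz
        unfold Dense' at hd
        have : nbd δ A ∩ Set.Icc (z - 1/16) (z + 1/16) = ∅ := by
          rw [Set.eq_empty_iff_forall_notMem]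
          rintro x ⟨hx, hx2⟩
          have h3 := nbd_sub hδ1 hL' hx
          apply hz
          rw [abs_le]
          constructor <;> linarith [h3.1, h3.2, hx2.1, hx2.2]
        rw [this] at hd
        simp at hd
        linarith
      refine le_trans (hD _ A z hz hd) (ENNReal.ofReal_le_ofReal ?_)
      have : 0 ≤ (1 - 3 * c0 / 32) ^ (n+1) * (2 * L + 2) * (1 / volume.real (nbd δ A)) := by
        positivity
      linarith
    · push Not at hd
      have e : n + 1 + m = (n + m) + 1 := by ring
      rw [e, Fail]
      set μ := volume.real (nbd δ A) with hμd
      set o : U → ℝ := fun u => volume.real (Prod.mk u ⁻¹' ovS W Fr (nbd δ A)) with ho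
      have hSm := measurableSet_ovS F.hW F.hFr (measurableSet_nbd δ A)
      have hom : Measurable (fun u => volume (Prod.mk u ⁻¹' ovS W Fr (nbd δ A))) :=
        measurable_measure_prodMk_left hSm
      have hole : ∀ u, volume (Prod.mk u ⁻¹' ovS W Fr (nbd δ A)) ≤ volume (nbd δ A) :=
        fun u => measure_mono (fun y hy => hy.2.1)
      have hoi : Integrable o ν := by
        refine Integrable.of_bound (C := μ) hom.ennreal_toReal.aestronglyMeasurable ?_
        refine Filter.Eventually.of_forall fun u => ?_
        rw [Real.norm_eq_abs, abs_of_nonneg measureReal_nonneg]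
        exact ENNReal.toReal_mono (nbd_fin δ A) (hole u)
      have hoint : ∫ u, o u ∂ν ≤ 4 * (3 * c0 / 64) * μ := by
        have h1 : ∫ u, o u ∂ν = (∫⁻ u, volume (Prod.mk u ⁻¹' ovS W Fr (nbd δ A)) ∂ν).toReal :=
          integral_toReal hom.aemeasurable
            (Filter.Eventually.of_forall fun u => lt_of_le_of_lt (hole u) (nbd_fin δ A).lt_top)
        rw [h1]
        have h2 := ENNReal.toReal_mono (ENNReal.mul_ne_top ENNReal.ofReal_ne_top (nbd_fin δ A))
          (ov_bound F A hd)
        rw [ENNReal.toReal_mul, ENNReal.toReal_ofReal (by positivity)] at h2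
        exact h2
      have hq : 3 * c0 / 8 ≤ ν.real Fr := by
        have h1 := F.F4r (Set.Icc (-(3/16)) (3/16)) measurableSet_Icc subset_rfl
        rw [Real.volume_real_Icc] at h1
        norm_num at h1
        have h2 : ν.real (Fr ∩ W ⁻¹' Set.Icc (-(3/16)) (3/16)) ≤ ν.real Fr :=
          measureReal_mono Set.inter_subset_left
        linarith
      set T := (1 - 3 * c0 / 32) ^ n * (2 * L + 2) with hT
      have hT0 : 0 ≤ T := by positivity
      have hind : Integrable (Fr.indicator (fun _ => (1:ℝ)/2)) ν :=
        (integrable_const _).indicator F.hFr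
      have hind' : Integrable (fun u => 1 - Fr.indicator (fun _ => (1:ℝ)/2) u) ν :=
        (integrable_const _).sub hind
      have hb : Integrable (fun u => (1 - Fr.indicator (fun _ => (1:ℝ)/2) u) + o u / (2 * μ)) ν :=
        ((integrable_const _).sub hind).add (hoi.div_const _)
      refine le_trans (lint_le ν _ (fun u => Ψ + T * (1 / μ *
        ((1 - Fr.indicator (fun _ => (1:ℝ)/2) u) + o u / (2 * μ)))) ?_ ?_ ?_) ?_
      · exact (integrable_const _).add ((hb.const_mul _).const_mul _)
      · intro u
        have h1 := (vol_step W Fr δ A u hμ)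
        have h2 : 0 ≤ 1 / volume.real (nbd δ (stepA W Fr A u)) := by
          have := h1.1; positivity
        have := mul_nonneg hT0 (h2.trans h1.2)
        simp only [ho]
        linarith
      · filter_upwards [F.F1] with u hu
        have h1 := (vol_step W Fr δ A u hμ)
        refine le_trans (ih (stepA W Fr A u) ?_ ?_) (ENNReal.ofReal_le_ofReal ?_)
        · unfold stepA; split_ifs
          · exact (hA.image _).mono Finset.subset_union_left
          · exact hA.image _
        · intro a ha
          have key : ∃ a' ∈ A, a = a' + W u ∨ a = a' - W u := by
            unfold stepA at ha
            split_ifs at ha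
            · simp only [Finset.mem_union, Finset.mem_image] at ha
              rcases ha with ⟨a', h, rfl⟩ | ⟨a', h, rfl⟩
              · exact ⟨a', h, Or.inl rfl⟩
              · exact ⟨a', h, Or.inr rfl⟩
            · simp only [Finset.mem_image] at ha
              rcases ha with ⟨a', h, rfl⟩
              exact ⟨a', h, Or.inl rfl⟩
          obtain ⟨a', ha', h⟩ := key
          have h3 := hL a' ha'
          push_cast at h3
          have : |a| ≤ |a'| + |W u| := by
            rcases h with rfl | rfl
            · exact abs_add_le _ _
            · exact abs_sub _ _
          linarith
        · have := mul_le_mul_of_nonneg_left h1.2 hT0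
          simp only [ho]
          linarith
      · apply ENNReal.ofReal_le_ofReal
        rw [integral_add (integrable_const _) ((hb.const_mul _).const_mul _), integral_const_mul,
          integral_const_mul, integral_add hind' (hoi.div_const _),
          integral_sub (integrable_const _) hind, integral_indicator_const _ F.hFr,
          integral_div]
        simp only [integral_const, probReal_univ, smul_eq_mul, one_mul]
        have h1 : (∫ u, o u ∂ν) / (2 * μ) ≤ 6 * c0 / 64 := by
          rw [div_le_iff₀ (by positivity)]; linarith
        have h2 : 1 - ν.real Fr * (1/2) + (∫ u, o u ∂ν) / (2 * μ) ≤ 1 - 3 * c0 / 32 := by linarith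
        have h3 := mul_le_mul_of_nonneg_left h2 (show 0 ≤ T * (1 / μ) by positivity)
        have h4 : (1 - 3 * c0 / 32) ^ (n+1) * (2 * L + 2) * (1 / μ) =
          T * (1 / μ) * (1 - 3 * c0 / 32) := by rw [hT]; ring
        rw [h4]
        linarith

lemma partA {ν : Measure U} {W : U → ℝ} {Fr : Set U} {B c0 : ℝ} (F : Facts ν W Fr B c0) :
    ∃ (p : ℝ) (D J0 : ℕ), 0 < p ∧ p ≤ 1 ∧ ∀ (J : ℕ) (τ : ℝ), J0 ≤ J → (1/8 : ℝ) ^ J ≤ τ → τ ≤ 1/8 →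
      Fail ν W Fr τ (D * J) {-(2 * τ)} ≤ ENNReal.ofReal (1 - p) := by
  have := F.prob
  have hB := F.hB
  have hc := F.c0pos
  have hc1 := F.c0le
  obtain ⟨h, c1, l, ρ, hc1p, hc1l, hl, hρ0, hρ1, hly⟩ :=
    lyap F (θ := 3 * c0 / 64) (by positivity) (by linarith)
  set γ := 1 - 3 * c0 / 32 with hγd
  have hγ0 : 0 ≤ γ := by rw [hγd]; linarith
  have hγ1 : γ < 1 := by rw [hγd]; linarith
  obtain ⟨D1, hD1⟩ := exists_pow_lt_of_lt_one (show (0:ℝ) < 1/16 by norm_num) hγ1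
  set E := Real.exp (l * (D1 * B)) with hE
  have hEp : 0 < E := Real.exp_pos _
  obtain ⟨D2, hD2⟩ := exists_pow_lt_of_lt_one (show (0:ℝ) < 1/(2*E) by positivity) hρ1
  have lim1 : Filter.Tendsto (fun J : ℕ => (1/2:ℝ)^J * Real.exp (l * 4)) Filter.atTop (nhds 0) := by
    have := (tendsto_pow_atTop_nhds_zero_of_lt_one (show (0:ℝ) ≤ 1/2 by norm_num)
      (by norm_num)).mul_const (Real.exp (l * 4))
    simpa using this
  have lim2 : Filter.Tendsto (fun J : ℕ => (1/2:ℝ)^J * (2 * (1 + D1 * B * J) + 2))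
      Filter.atTop (nhds 0) := by
    have h1 := tendsto_self_mul_const_pow_of_lt_one (show (0:ℝ) ≤ 1/2 by norm_num) (by norm_num)
    have h2 := tendsto_pow_atTop_nhds_zero_of_lt_one (show (0:ℝ) ≤ 1/2 by norm_num) (by norm_num)
    have h3 := (h2.const_mul 4).add (h1.const_mul (2 * (D1 * B)))
    simp only [mul_zero, add_zero] at h3
    refine h3.congr fun J => ?_
    ring
  have ev1 := lim1.eventually (eventually_lt_nhds (show (0:ℝ) < c1 / 4 by positivity))
  have ev2 := lim2.eventually (eventually_lt_nhds (show (0:ℝ) < c1 / 4 by positivity))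
  obtain ⟨J1, hJ1⟩ := Filter.eventually_atTop.1 (ev1.and ev2)
  refine ⟨c1 / 4, D1 + D2 + 1, max J1 h, by positivity, by linarith, ?_⟩
  intro J τ hJ hτ hτ1
  obtain ⟨g1, g2⟩ := hJ1 J ((le_max_left _ _).trans hJ)
  have hhJ : h ≤ J := (le_max_right _ _).trans hJ
  have hτ0 : 0 < τ := lt_of_lt_of_le (by positivity) hτ
  obtain ⟨r, hr⟩ : ∃ r, J = h + r := ⟨J - h, by omega⟩
  have en : (D1 + D2 + 1) * J = D1 * J + (h + (D2 * J + r)) := by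
    calc (D1 + D2 + 1) * J = D1 * J + D2 * J + J := by ring
      _ = D1 * J + D2 * J + (h + r) := by rw [← hr]
      _ = _ := by ring
  rw [en]
  have hJn : (0:ℝ) ≤ J := by positivity
  have key := growth F (δ := τ) (L := 1 + D1 * B * J) (Ψ := 1 - c1 / 2) hτ0 (by linarith)
    (by linarith) (h + (D2 * J + r)) ?_ (D1 * J) {-(2 * τ)} (Finset.singleton_nonempty _) ?_
  · refine key.trans (ENNReal.ofReal_le_ofReal ?_)
    have hv := le_vol_nbd hτ0 (Finset.singleton_nonempty (-(2 * τ)))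
    have h1 : 1 / volume.real (nbd τ {-(2 * τ)}) ≤ 8 ^ J := by
      rw [div_le_iff₀ (lt_of_lt_of_le hτ0 hv)]
      have : (8:ℝ) ^ J * (1/8) ^ J = 1 := by rw [← mul_pow]; norm_num
      nlinarith [show (0:ℝ) < 8 ^ J by positivity]
    have h2 : (1 - 3 * c0 / 32) ^ (D1 * J) ≤ (1/16) ^ J := by
      rw [pow_mul]; exact pow_le_pow_left₀ (by positivity) hD1.le J
    have h3 : (1 - 3 * c0 / 32) ^ (D1 * J) * (2 * (1 + D1 * B * J) + 2) *
        (1 / volume.real (nbd τ {-(2 * τ)})) ≤ (1/16) ^ J * (2 * (1 + D1 * B * J) + 2) * 8 ^ J := by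
      gcongr
    have h4 : (1/16:ℝ) ^ J * (2 * (1 + D1 * B * J) + 2) * 8 ^ J =
        (1/2) ^ J * (2 * (1 + D1 * B * J) + 2) := by
      have : (1/2:ℝ) ^ J = (1/16) ^ J * 8 ^ J := by rw [← mul_pow]; norm_num
      rw [this]; ring
    linarith
  · intro n A z hz hd
    have e2 : n + (h + (D2 * J + r)) = h + (D2 * J + (r + n)) := by ring
    rw [e2]
    refine (hly τ _ A z hd).trans (ENNReal.ofReal_le_ofReal ?_)
    have h1 : ρ ^ (D2 * J + (r + n)) ≤ (1 / (2 * E)) ^ J := by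
      rw [pow_add, pow_mul]
      calc _ ≤ (1 / (2 * E)) ^ J * 1 := by
            gcongr
            exact pow_le_one₀ hρ0 hρ1.le
        _ = _ := mul_one _
    have h2 : Real.exp (l * |z|) ≤ E ^ J * Real.exp (l * 4) := by
      rw [hE, ← Real.exp_nat_mul, ← Real.exp_add]
      apply Real.exp_le_exp.2
      have := mul_le_mul_of_nonneg_left hz hl
      nlinarith
    have h3 : ρ ^ (D2 * J + (r + n)) * Real.exp (l * |z|) ≤
        (1 / (2 * E)) ^ J * (E ^ J * Real.exp (l * 4)) := by gcongr
    have h4 : (1 / (2 * E)) ^ J * (E ^ J * Real.exp (l * 4)) = (1/2) ^ J * Real.exp (l * 4) := by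
      rw [← mul_assoc, ← mul_pow]
      congr 2
      field_simp
    linarith
  · intro a ha
    rw [Finset.mem_singleton] at ha
    rw [ha, abs_neg, abs_of_pos (by positivity)]
    push_cast
    nlinarith

end Abs4

section PB

/-- the law of a signed edge weight -/
noncomputable def kap (b : ℝ) : Measure ℝ :=
  (2:ℝ≥0∞)⁻¹ • (volume.restrict (Set.Icc b (b+1)) + volume.restrict (Set.Icc (-(b+1)) (-b)))

lemma kap_apply (b : ℝ) {M : Set ℝ} (hM : MeasurableSet M) : kap b M =
    (2:ℝ≥0∞)⁻¹ * (volume (M ∩ Set.Icc b (b+1)) + volume (M ∩ Set.Icc (-(b+1)) (-b))) := by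
  simp [kap, Measure.restrict_apply hM, mul_add]

instance kap_prob (b : ℝ) : IsProbabilityMeasure (kap b) := by
  constructor
  rw [kap_apply b MeasurableSet.univ]
  simp only [Set.univ_inter, Real.volume_Icc]
  norm_num
  exact ENNReal.inv_mul_cancel (by norm_num) (by norm_num)

lemma kap_le (b : ℝ) {M : Set ℝ} (hM : MeasurableSet M) : kap b M ≤ volume M := by
  rw [kap_apply b hM]
  calc _ ≤ (2:ℝ≥0∞)⁻¹ * (volume M + volume M) := by
        gcongr <;> exact Set.inter_subset_left
    _ = volume M := by
        rw [← two_mul, ← mul_assoc, ENNReal.inv_mul_cancel (by norm_num) (by norm_num), one_mul]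

noncomputable def bet (b : ℝ) : ℝ := |b + 1/2|

lemma kap_ge (b : ℝ) {M : Set ℝ} (hM : MeasurableSet M)
    (h : M ⊆ Set.Icc (bet b + 1/8) (bet b + 1/2) ∨
      M ⊆ Set.Icc (-(bet b + 1/2)) (-(bet b + 1/8))) : (2:ℝ≥0∞)⁻¹ * volume M ≤ kap b M := by
  rw [kap_apply b hM]
  gcongr
  have : M ⊆ Set.Icc b (b+1) ∨ M ⊆ Set.Icc (-(b+1)) (-b) := by
    unfold bet at h
    rcases le_or_gt 0 (b + 1/2) with hb | hb
    · rw [abs_of_nonneg hb] at h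
      rcases h with h | h
      · left; exact h.trans (Set.Icc_subset_Icc (by linarith) (by linarith))
      · right; exact h.trans (Set.Icc_subset_Icc (by linarith) (by linarith))
    · rw [abs_of_neg hb] at h
      rcases h with h | h
      · right; exact h.trans (Set.Icc_subset_Icc (by linarith) (by linarith))
      · left; exact h.trans (Set.Icc_subset_Icc (by linarith) (by linarith))
  rcases this with h | h
  · rw [Set.inter_eq_self_of_subset_left h]; exact le_self_add
  · rw [Set.inter_eq_self_of_subset_left h]; exact le_add_self

lemma kap_bd (b : ℝ) : ∀ᵐ x ∂(kap b), |x| ≤ bet b + 1/2 := by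
  have hm : MeasurableSet {x : ℝ | |x| ≤ bet b + 1/2}ᶜ :=
    (measurableSet_le (measurable_norm) measurable_const).compl
  rw [ae_iff]
  change kap b {x : ℝ | |x| ≤ bet b + 1/2}ᶜ = 0
  rw [kap_apply b hm]
  have h1 : {x : ℝ | |x| ≤ bet b + 1/2}ᶜ ∩ Set.Icc b (b+1) = ∅ := by
    rw [Set.eq_empty_iff_forall_notMem]
    rintro x ⟨hx, h1, h2⟩
    apply hx
    change |x| ≤ |b + 1/2| + 1/2
    have := le_abs_self (b+1/2)
    have := neg_abs_le (b+1/2)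
    rw [abs_le]; constructor <;> linarith
  have h2 : {x : ℝ | |x| ≤ bet b + 1/2}ᶜ ∩ Set.Icc (-(b+1)) (-b) = ∅ := by
    rw [Set.eq_empty_iff_forall_notMem]
    rintro x ⟨hx, h1, h2⟩
    apply hx
    change |x| ≤ |b + 1/2| + 1/2
    have := le_abs_self (b+1/2)
    have := neg_abs_le (b+1/2)
    rw [abs_le]; constructor <;> linarith
  rw [h1, h2]; simp

lemma kap_int (b : ℝ) : Integrable (fun x => x) (kap b) :=
  Integrable.of_bound measurable_id.aestronglyMeasurable _ (kap_bd b)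

lemma kap_mean (b : ℝ) : ∫ x, x ∂(kap b) = 0 := by
  have h1 : Integrable (fun x : ℝ => x) (volume.restrict (Set.Icc b (b+1))) :=
    continuous_id.integrableOn_Icc
  have h2 : Integrable (fun x : ℝ => x) (volume.restrict (Set.Icc (-(b+1)) (-b))) :=
    continuous_id.integrableOn_Icc
  rw [kap, integral_smul_measure, integral_add_measure h1 h2,
    integral_Icc_eq_integral_Ioc, integral_Icc_eq_integral_Ioc,
    ← intervalIntegral.integral_of_le (by linarith), ← intervalIntegral.integral_of_le (by linarith),
    integral_id, integral_id]
  simp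
  ring

noncomputable def nu (b : ℝ) : Measure (Fin 3 → ℝ) := Measure.pi (fun _ => kap b)

instance nu_prob (b : ℝ) : IsProbabilityMeasure (nu b) := by unfold nu; infer_instance

def WW (u : Fin 3 → ℝ) : ℝ := u 0 + u 1

def FF (b : ℝ) : Set (Fin 3 → ℝ) :=
  {u | u 0 ∈ Set.Ioo (bet b + 1/8) (bet b + 3/8) ∧ -u 1 ∈ Set.Ioo (bet b + 1/8) (bet b + 3/8) ∧
    bet b + 3/8 < u 2}

lemma measurable_WW : Measurable WW := (measurable_pi_apply 0).add (measurable_pi_apply 1)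

lemma measurableSet_FF (b : ℝ) : MeasurableSet (FF b) := by
  refine ((measurable_pi_apply 0) measurableSet_Ioo).inter (MeasurableSet.inter ?_ ?_)
  · exact ((measurable_pi_apply (X := fun _ : Fin 3 => ℝ) 1).neg) measurableSet_Ioo
  · exact (measurable_pi_apply (X := fun _ : Fin 3 => ℝ) 2) measurableSet_Ioi

lemma nu_apply (b : ℝ) {S : Set (Fin 3 → ℝ)} (hS : MeasurableSet S) :
    nu b S = ∫⁻ y, kap b {x | (Fin.cons x y : Fin 3 → ℝ) ∈ S}
      ∂(Measure.pi (fun _ : Fin 2 => kap b)) := by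
  have hp := (measurePreserving_piFinSuccAbove (fun _ : Fin 3 => kap b) 0).symm
  unfold nu
  rw [← hp.measure_preimage hS.nullMeasurableSet, Measure.prod_apply_symm (hp.measurable hS)]
  refine lintegral_congr fun y => ?_
  congr 1
  ext x
  simp [MeasurableEquiv.piFinSuccAbove, Fin.insertNthEquiv]

lemma nu_F3 (b : ℝ) (M : Set ℝ) (hM : MeasurableSet M) :
    nu b (FF b ∩ WW ⁻¹' M) ≤ volume M := by
  rw [nu_apply b ((measurableSet_FF b).inter (measurable_WW hM))]
  calc _ ≤ ∫⁻ y : Fin 2 → ℝ, volume M ∂(Measure.pi (fun _ : Fin 2 => kap b)) := by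
        refine lintegral_mono fun y => ?_
        have : {x | (Fin.cons x y : Fin 3 → ℝ) ∈ FF b ∩ WW ⁻¹' M} ⊆ (fun x => x + y 0) ⁻¹' M := by
          rintro x ⟨-, hx⟩
          exact hx
        refine (measure_mono this).trans ((kap_le b ((measurable_add_const _) hM)).trans ?_)
        rw [measure_preimage_add_right]
    _ = volume M := by simp

lemma nu_F4h (b t : ℝ) (M : Set ℝ) (hM : MeasurableSet M) (ht : bet b + 1/8 ≤ t)
    (ht2 : t + 1/16 ≤ bet b + 3/8)
    (h : ∀ x ∈ M, ∀ y ∈ Set.Ioo t (t + 1/16), x + y ∈ Set.Ioo (bet b + 1/8) (bet b + 3/8)) :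
    ENNReal.ofReal (1/1024) * volume M ≤ nu b (FF b ∩ WW ⁻¹' M) := by
  rw [nu_apply b ((measurableSet_FF b).inter (measurable_WW hM))]
  set T : Set ℝ := Set.Ioo (-(t + 1/16)) (-t) with hT
  set S : Set ℝ := Set.Ioo (bet b + 3/8) (bet b + 1/2) with hS
  set Q : Set (Fin 2 → ℝ) := Set.pi Set.univ ![T, S] with hQ
  have hQm : MeasurableSet Q := by
    refine MeasurableSet.univ_pi fun i => ?_
    fin_cases i
    · exact measurableSet_Ioo
    · exact measurableSet_Ioo
  have hQv : ENNReal.ofReal (1/512) ≤ Measure.pi (fun _ : Fin 2 => kap b) Q := by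
    rw [hQ, Measure.pi_pi, Fin.prod_univ_two]
    simp only [Matrix.cons_val_zero, Matrix.cons_val_one]
    have h1 : (2:ℝ≥0∞)⁻¹ * volume T ≤ kap b T := kap_ge b measurableSet_Ioo
      (Or.inr (Set.Ioo_subset_Icc_self.trans (Set.Icc_subset_Icc (by linarith) (by linarith))))
    have h2 : (2:ℝ≥0∞)⁻¹ * volume S ≤ kap b S := kap_ge b measurableSet_Ioo
      (Or.inl (Set.Ioo_subset_Icc_self.trans (Set.Icc_subset_Icc (by linarith) (by linarith))))
    refine le_trans ?_ (mul_le_mul' h1 h2)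
    rw [hT, hS, Real.volume_Ioo, Real.volume_Ioo]
    have e : (2:ℝ≥0∞)⁻¹ = ENNReal.ofReal (1/2) := by
      rw [ENNReal.ofReal_div_of_pos (by norm_num)]; simp
    rw [e, ← ENNReal.ofReal_mul (by norm_num), ← ENNReal.ofReal_mul (by norm_num),
      ← ENNReal.ofReal_mul]
    · apply ENNReal.ofReal_le_ofReal
      have e1 : -t - -(t + 1/16) = 1/16 := by ring
      have e2 : bet b + 1/2 - (bet b + 3/8) = 1/8 := by ring
      rw [e1, e2]; norm_num
    · have e1 : -t - -(t + 1/16) = 1/16 := by ring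
      rw [e1]; norm_num
  calc _ ≤ ((2:ℝ≥0∞)⁻¹ * volume M) * Measure.pi (fun _ : Fin 2 => kap b) Q := by
        refine le_trans ?_ (mul_le_mul' le_rfl hQv)
        have e : (2:ℝ≥0∞)⁻¹ = ENNReal.ofReal (1/2) := by
          rw [ENNReal.ofReal_div_of_pos (by norm_num)]; simp
        rw [e, mul_assoc, mul_comm (volume M), ← mul_assoc, ← ENNReal.ofReal_mul (by norm_num)]
        gcongr
        norm_num
    _ = ∫⁻ y, Q.indicator (fun _ => (2:ℝ≥0∞)⁻¹ * volume M) y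
          ∂(Measure.pi (fun _ : Fin 2 => kap b)) := by
        rw [lintegral_indicator_const hQm]
    _ ≤ _ := by
        refine lintegral_mono fun y => ?_
        by_cases hy : y ∈ Q
        · simp only [hy, Set.indicator_of_mem]
          have hy0 : y 0 ∈ T := hy 0 (Set.mem_univ _)
          have hy1 : y 1 ∈ S := hy 1 (Set.mem_univ _)
          have hsub : (fun x => x + y 0) ⁻¹' M ⊆
              {x | (Fin.cons x y : Fin 3 → ℝ) ∈ FF b ∩ WW ⁻¹' M} := by
            intro x hx
            refine ⟨⟨?_, ?_, hy1.1⟩, hx⟩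
            · have := h _ hx (-(y 0)) ⟨by linarith [hy0.2], by linarith [hy0.1]⟩
              simpa using this
            · change -(y 0) ∈ _
              constructor <;> linarith [hy0.1, hy0.2]
          refine le_trans ?_ (measure_mono hsub)
          refine le_trans ?_ (kap_ge b ((measurable_add_const _) hM) (Or.inl ?_))
          · rw [measure_preimage_add_right]
          · intro x hx
            have := h _ hx (-(y 0)) ⟨by linarith [hy0.2], by linarith [hy0.1]⟩
            simp only [add_neg_cancel_right] at this
            exact ⟨this.1.le, by linarith [this.2]⟩
        · simp [hy]

lemma nu_F4 (b : ℝ) (M : Set ℝ) (hM : MeasurableSet M) (h : M ⊆ Set.Icc (-(3/16)) (3/16)) :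
    ENNReal.ofReal (1/1024) * volume M ≤ nu b (FF b ∩ WW ⁻¹' M) := by
  have hI : MeasurableSet (Set.Ici (0:ℝ)) := measurableSet_Ici
  rw [← measure_inter_add_sdiff M hI, mul_add,
    ← measure_inter_add_sdiff (FF b ∩ WW ⁻¹' M) (measurable_WW hI)]
  refine add_le_add ?_ ?_
  · rw [Set.inter_assoc, ← Set.preimage_inter]
    refine nu_F4h b (bet b + 1/8) _ (hM.inter hI) le_rfl (by linarith) ?_
    rintro x ⟨hx, hx0⟩ y ⟨hy1, hy2⟩
    have h1 := h hx
    have h2 : 0 ≤ x := hx0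
    constructor <;> linarith [h1.2]
  · rw [Set.inter_sdiff_assoc, ← Set.preimage_sdiff]
    refine nu_F4h b (bet b + 5/16) _ (hM.diff hI) (by linarith) (by linarith) ?_
    rintro x ⟨hx, hx0⟩ y ⟨hy1, hy2⟩
    have h1 := h hx
    have h2 : x < 0 := not_le.1 hx0
    constructor <;> linarith [h1.1]

lemma nu_facts (b : ℝ) : Facts (nu b) WW (FF b) (2 * bet b + 1) (1/1024) where
  prob := nu_prob b
  hW := measurable_WW
  hFr := measurableSet_FF b
  hB := by have := abs_nonneg (b + 1/2); unfold bet; linarith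
  c0pos := by norm_num
  c0le := by norm_num
  F1 := by
    have h : ∀ i : Fin 3, ∀ᵐ u ∂(nu b), |u i| ≤ bet b + 1/2 := by
      intro i
      have := (measurePreserving_eval (fun _ : Fin 3 => kap b) i).quasiMeasurePreserving.ae
        (kap_bd b)
      exact this
    filter_upwards [h 0, h 1] with u h0 h1
    unfold WW
    exact (abs_add_le _ _).trans (by linarith)
  F2 := by
    have h : ∀ i : Fin 3, Integrable (fun u : Fin 3 → ℝ => u i) (nu b) ∧
        ∫ u, u i ∂(nu b) = 0 := by
      intro i
      have hp := measurePreserving_eval (fun _ : Fin 3 => kap b) i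
      refine ⟨hp.integrable_comp_of_integrable (kap_int b), ?_⟩
      have h2 := integral_map (μ := Measure.pi (fun _ : Fin 3 => kap b)) (f := fun x : ℝ => x)
        hp.measurable.aemeasurable measurable_id.aestronglyMeasurable
      rw [hp.map_eq, kap_mean] at h2
      exact h2.symm
    unfold WW
    rw [integral_add (h 0).1 (h 1).1, (h 0).2, (h 1).2, add_zero]
  F3a := by
    rintro u ⟨h1, h2, -⟩
    unfold WW
    rw [abs_le]
    constructor <;> linarith [h1.1, h1.2, h2.1, h2.2]
  F3 := nu_F3 b
  F4 := nu_F4 b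

end PB

section PD

/-- abstract counter dynamics -/
def CImp {ι : Type*} [DecidableEq ι] (w : ι → ℝ) : Finset ι → List (Finset ι) → Prop
  | _, [] => True
  | C, D :: L => 0 < ∑ s ∈ D, (if s ∈ C then - w s else w s) ∧ CImp w (symmDiff C D) L

noncomputable def capp {ι : Type*} [DecidableEq ι] : Finset ι → List (Finset ι) → Finset ι
  | C, [] => C
  | C, D :: L => capp (symmDiff C D) L

lemma capp_append {ι : Type*} [DecidableEq ι] (L1 L2 : List (Finset ι)) : ∀ C : Finset ι,
    capp C (L1 ++ L2) = capp (capp C L1) L2 := by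
  induction L1 with
  | nil => intro C; rfl
  | cons D L ih => intro C; simp only [List.cons_append, capp]; exact ih _

lemma cimp_append {ι : Type*} [DecidableEq ι] (w : ι → ℝ) (L1 L2 : List (Finset ι)) : ∀ C : Finset ι,
    CImp w C (L1 ++ L2) ↔ CImp w C L1 ∧ CImp w (capp C L1) L2 := by
  induction L1 with
  | nil => intro C; simp [CImp, capp]
  | cons D L ih => intro C; simp only [List.cons_append, CImp, capp, ih, and_assoc]

noncomputable def cL {ι : Type*} [DecidableEq ι] (a : ℕ → ι) : ℕ → List (Finset ι)
  | 0 => [{a 0}]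
  | j + 1 => cL a j ++ ([{a (2*j), a (2*j+1)}] ++ (cL a j ++ [{a (2*j), a (2*j+1), a (2*j+2)}]))

lemma cL_len {ι : Type*} [DecidableEq ι] (a : ℕ → ι) (j : ℕ) : 2 ^ j ≤ (cL a j).length := by
  induction j with
  | zero => simp [cL]
  | succ j ih => simp only [cL, List.length_append, List.length_cons, pow_succ]; omega

lemma cL_card {ι : Type*} [DecidableEq ι] (a : ℕ → ι) (j : ℕ) : ∀ S ∈ cL a j, S.card ≤ 3 := by
  induction j with
  | zero => intro S hS; simp only [cL, List.mem_singleton] at hS; simp [hS]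
  | succ j ih =>
    intro S hS
    simp only [cL, List.mem_append, List.mem_singleton] at hS
    rcases hS with h | rfl | h | rfl
    · exact ih S h
    · exact Finset.card_le_two.trans (by norm_num)
    · exact ih S h
    · exact Finset.card_le_three

lemma cL_imp {ι : Type*} [DecidableEq ι] (w : ι → ℝ) (a : ℕ → ι) (j : ℕ)
    (hinj : ∀ i i', i < i' → i' ≤ 2 * j → a i ≠ a i')
    (h0 : 0 < w (a 0))
    (h1 : ∀ i, i + 1 ≤ 2 * j → w (a i) < w (a (i+1)))
    (h2 : ∀ i, i + 2 ≤ 2 * j → w (a i) + w (a (i+1)) < w (a (i+2))) :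
    ∀ C : Finset ι, (∀ i ≤ 2 * j, a i ∉ C) →
      CImp w C (cL a j) ∧ capp C (cL a j) = insert (a (2 * j)) C := by
  induction j with
  | zero =>
    intro C hC
    have := hC 0 (by simp)
    simp only [cL, CImp, capp, mul_zero, and_true, Finset.sum_singleton, if_neg this]
    refine ⟨h0, ?_⟩
    ext x
    simp only [Finset.mem_symmDiff, Finset.mem_singleton, Finset.mem_insert]
    by_cases hx : x = a 0
    · subst hx; simp [this]
    · simp [hx]
  | succ j ih =>
    intro C hC
    have ih' := ih (fun i i' h h' => hinj i i' h (by omega)) (fun i h => h1 i (by omega))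
      (fun i h => h2 i (by omega))
    have n01 := hinj (2*j) (2*j+1) (by omega) (by omega)
    have n02 := hinj (2*j) (2*j+2) (by omega) (by omega)
    have n12 := hinj (2*j+1) (2*j+2) (by omega) (by omega)
    have c0 := hC (2*j) (by omega)
    have c1 := hC (2*j+1) (by omega)
    have c2 := hC (2*j+2) (by omega)
    obtain ⟨i1, e1⟩ := ih' C (fun i hi => hC i (by omega))
    have e2 : symmDiff (insert (a (2*j)) C) {a (2*j), a (2*j+1)} = insert (a (2*j+1)) C := by
      ext x
      simp only [Finset.mem_symmDiff, Finset.mem_insert, Finset.mem_singleton]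
      by_cases hx0 : x = a (2*j)
      · subst hx0; simp [c0, n01]
      · by_cases hx1 : x = a (2*j+1)
        · subst hx1; simp [c1, hx0]
        · simp [hx0, hx1]
    obtain ⟨i3, e3⟩ := ih' (insert (a (2*j+1)) C) (by
      intro i hi
      simp only [Finset.mem_insert, not_or]
      exact ⟨hinj i (2*j+1) (by omega) (by omega), hC i (by omega)⟩)
    have e4 : symmDiff (insert (a (2*j)) (insert (a (2*j+1)) C)) {a (2*j), a (2*j+1), a (2*j+2)} =
        insert (a (2*j+2)) C := by
      ext x
      simp only [Finset.mem_symmDiff, Finset.mem_insert, Finset.mem_singleton]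
      by_cases hx0 : x = a (2*j)
      · subst hx0; simp [c0, n02]
      · by_cases hx1 : x = a (2*j+1)
        · subst hx1; simp [c1, n12]
        · by_cases hx2 : x = a (2*j+2)
          · subst hx2; simp [c2, hx0, hx1]
          · simp [hx0, hx1, hx2]
    have g1 := h1 (2*j) (by omega)
    have g2 := h2 (2*j) (by omega)
    constructor
    · simp only [cL, cimp_append, capp_append, e1, CImp, capp, e2, e3, and_true]
      refine ⟨i1, ?_, i3, ?_⟩
      · rw [Finset.sum_pair n01]
        simp only [Finset.mem_insert, true_or, if_true, n01.symm, c1, or_self, if_false]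
        linarith
      · rw [Finset.sum_insert (by simp [n01, n02]), Finset.sum_pair n12]
        simp only [Finset.mem_insert, true_or, or_true, if_true, n02.symm, n12.symm, c2, or_self,
          if_false]
        linarith
    · simp only [cL, capp_append, e1, capp, e2, e3, e4]
      rfl

abbrev EE (J n : ℕ) := Fin J × Fin n × Fin 3
abbrev WT (J n : ℕ) := Fin J ⊕ EE J n

def parW {J n : ℕ} (e : EE J n) : WT J n :=
  if e.2.2 = 2 then Sum.inr (e.1, e.2.1, 0) else Sum.inl e.1

/-- edge flipped by a set -/
def xf {J n : ℕ} (T : Finset (WT J n)) (e : EE J n) : Prop :=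
  Xor (Sum.inr e ∈ T) (parW e ∈ T)

noncomputable def act {J n : ℕ} (c : EE J n → ℝ) (T : Finset (WT J n)) : EE J n → ℝ :=
  fun e => if xf T e then - c e else c e

noncomputable def gain {J n : ℕ} (c : EE J n → ℝ) (T : Finset (WT J n)) : ℝ :=
  ∑ e, if xf T e then c e else 0

def ImpC {J n : ℕ} : (EE J n → ℝ) → List (Finset (WT J n)) → Prop
  | _, [] => True
  | c, T :: L => 0 < gain c T ∧ ImpC (act c T) L

noncomputable def acts {J n : ℕ} : (EE J n → ℝ) → List (Finset (WT J n)) → (EE J n → ℝ)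
  | c, [] => c
  | c, T :: L => acts (act c T) L

lemma impC_append {J n : ℕ} (L1 L2 : List (Finset (WT J n))) : ∀ c,
    ImpC c (L1 ++ L2) ↔ ImpC c L1 ∧ ImpC (acts c L1) L2 := by
  induction L1 with
  | nil => intro C; simp [ImpC, acts]
  | cons D L ih => intro C; simp only [List.cons_append, ImpC, acts, ih, and_assoc]

/-- centre moves -/
noncomputable def cen {J n : ℕ} (D : Finset (Fin J)) : Finset (WT J n) := D.map ⟨Sum.inl, Sum.inl_injective⟩

lemma xf_cen {J n : ℕ} (D : Finset (Fin J)) (e : EE J n) :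
    xf (cen D) e ↔ (e.2.2 ≠ 2 ∧ e.1 ∈ D) := by
  unfold xf cen parW
  by_cases h : e.2.2 = 2
  · simp [h, Xor]
  · simp [h, Xor]

def fld {J n : ℕ} (c : EE J n → ℝ) (s : Fin J) : ℝ := ∑ i, (c (s, i, 0) + c (s, i, 1))

noncomputable def stt {J n : ℕ} (c : EE J n → ℝ) (C : Finset (Fin J)) : EE J n → ℝ :=
  fun e => if e.2.2 ≠ 2 ∧ e.1 ∈ C then - c e else c e

lemma act_stt {J n : ℕ} (c : EE J n → ℝ) (C D : Finset (Fin J)) :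
    act (stt c C) (cen D) = stt c (symmDiff C D) := by
  ext e
  simp only [act, stt, xf_cen, Finset.mem_symmDiff]
  by_cases h : e.2.2 = 2
  · simp [h]
  · by_cases h1 : e.1 ∈ C <;> by_cases h2 : e.1 ∈ D <;> simp [h, h1, h2]

lemma gain_stt {J n : ℕ} (c : EE J n → ℝ) (C D : Finset (Fin J)) :
    gain (stt c C) (cen D) = ∑ s ∈ D, (if s ∈ C then - fld c s else fld c s) := by
  unfold gain
  simp only [xf_cen, stt]
  rw [Fintype.sum_prod_type]
  have : ∀ s : Fin J, ∑ y : Fin n × Fin 3, (if y.2 ≠ 2 ∧ s ∈ D then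
      (if y.2 ≠ 2 ∧ s ∈ C then - c (s, y) else c (s, y)) else 0) =
      if s ∈ D then (if s ∈ C then - fld c s else fld c s) else 0 := by
    intro s
    rw [Fintype.sum_prod_type]
    by_cases h2 : s ∈ D
    · by_cases h1 : s ∈ C
      · simp only [h1, h2, and_true, if_true, fld, ← Finset.sum_neg_distrib]
        refine Finset.sum_congr rfl fun i _ => ?_
        rw [Fin.sum_univ_three]
        simp
        ring
      · simp only [h1, h2, and_true, and_false, if_true, if_false, fld]
        refine Finset.sum_congr rfl fun i _ => ?_
        rw [Fin.sum_univ_three]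
        simp
    · simp [h2]
  rw [Finset.sum_congr rfl fun s _ => this s, ← Finset.sum_filter]
  simp

lemma impC_cen {J n : ℕ} (c : EE J n → ℝ) (L : List (Finset (Fin J))) : ∀ C,
    CImp (fld c) C L → ImpC (stt c C) (L.map cen) := by
  induction L with
  | nil => intro C _; trivial
  | cons D L ih =>
    intro C h
    refine ⟨?_, ?_⟩
    · rw [gain_stt]; exact h.1
    · rw [act_stt]; exact ih _ h.2

/-- unit moves -/
noncomputable def unt {J n : ℕ} (p : Fin J × Fin n) : Finset (WT J n) :=
  {Sum.inr (p.1, p.2, 0), Sum.inr (p.1, p.2, 1)}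

lemma xf_unt {J n : ℕ} (p : Fin J × Fin n) (e : EE J n) :
    xf (unt p) e ↔ (e.1, e.2.1) = p := by
  obtain ⟨s, i, j⟩ := e
  obtain ⟨s', i'⟩ := p
  unfold xf unt parW Xor
  by_cases h : s = s' ∧ i = i'
  · obtain ⟨rfl, rfl⟩ := h
    fin_cases j <;> simp
  · fin_cases j <;> simp [h]

lemma gain_unt {J n : ℕ} (c : EE J n → ℝ) (p : Fin J × Fin n) :
    gain c (unt p) = c (p.1, p.2, 0) + c (p.1, p.2, 1) + c (p.1, p.2, 2) := by
  unfold gain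
  simp only [xf_unt]
  rw [Fintype.sum_prod_type, Finset.sum_eq_single p.1]
  · rw [Fintype.sum_prod_type, Finset.sum_eq_single p.2]
    · rw [Fin.sum_univ_three]; simp
    · intro i _ hi
      refine Finset.sum_eq_zero fun j _ => if_neg ?_
      rintro h; exact hi (by rw [← h])
    · simp
  · intro s _ hs
    refine Finset.sum_eq_zero fun j _ => if_neg ?_
    rintro h; exact hs (by rw [← h])
  · simp

lemma impC_unt {J n : ℕ} (l : List (Fin J × Fin n)) (hl : l.Nodup) : ∀ c : EE J n → ℝ,
    (∀ p ∈ l, 0 < c (p.1, p.2, 0) + c (p.1, p.2, 1) + c (p.1, p.2, 2)) →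
    ImpC c (l.map unt) ∧
      acts c (l.map unt) = fun e => if (e.1, e.2.1) ∈ l then - c e else c e := by
  induction l with
  | nil => intro c _; exact ⟨trivial, by simp [acts]⟩
  | cons p l ih =>
    intro c h
    rw [List.nodup_cons] at hl
    have hact : ∀ e : EE J n, (e.1, e.2.1) ≠ p → act c (unt p) e = c e := by
      intro e he
      simp only [act, xf_unt, he, if_false]
    obtain ⟨h1, h2⟩ := ih hl.2 (act c (unt p)) (by
      intro p' hp'
      have hne : p' ≠ p := fun h => hl.1 (h ▸ hp')
      rw [hact _ hne, hact _ hne, hact _ hne]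
      exact h p' (List.mem_cons_of_mem _ hp'))
    refine ⟨⟨?_, h1⟩, ?_⟩
    · rw [gain_unt]; exact h p List.mem_cons_self
    · simp only [List.map_cons, acts]
      rw [h2]
      ext e
      by_cases he : (e.1, e.2.1) = p
      · have : (e.1, e.2.1) ∉ l := he ▸ hl.1
        rw [if_neg this, if_pos (by rw [he]; exact List.mem_cons_self)]
        simp [act, xf_unt, he]
      · rw [hact e he]
        simp [he]

/-- the graph -/
def edg {J n : ℕ} {V : Type*} (φ : WT J n ≃ V) (e : EE J n) : Sym2 V :=
  s(φ (Sum.inr e), φ (parW e))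

def HG {J n : ℕ} {V : Type*} (φ : WT J n ≃ V) : SimpleGraph V :=
  SimpleGraph.fromEdgeSet (Set.range (edg φ))

lemma parW_ne {J n : ℕ} (e : EE J n) : Sum.inr e ≠ parW e := by
  obtain ⟨s, i, j⟩ := e
  fin_cases j <;> simp [parW]

lemma edg_inj {J n : ℕ} {V : Type*} (φ : WT J n ≃ V) : Function.Injective (edg φ) := by
  intro e e' h
  unfold edg at h
  rw [Sym2.eq_iff] at h
  simp only [φ.injective.eq_iff] at h
  rcases h with ⟨h, -⟩ | ⟨h1, h2⟩
  · exact Sum.inr_injective h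
  · obtain ⟨s, i, j⟩ := e
    obtain ⟨s', i', j'⟩ := e'
    fin_cases j <;> fin_cases j' <;> simp_all [parW]

lemma HG_edgeSet {J n : ℕ} {V : Type*} (φ : WT J n ≃ V) :
    (HG φ).edgeSet = Set.range (edg φ) := by
  unfold HG
  rw [SimpleGraph.edgeSet_fromEdgeSet]
  ext x
  simp only [Set.mem_sdiff, Set.mem_range, and_iff_left_iff_imp]
  rintro ⟨e, rfl⟩ h
  have : φ (Sum.inr e) = φ (parW e) := by simpa [edg] using h
  exact parW_ne e (φ.injective this)

noncomputable def cOf {J n : ℕ} {V : Type*} (φ : WT J n ≃ V) (X : Sym2 V → ℝ) (σ : V → ℝ)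
    (e : EE J n) : ℝ := σ (φ (Sum.inr e)) * σ (φ (parW e)) * X (edg φ e)

lemma cutValue_eq {J n : ℕ} {V : Type*} [Fintype V] (φ : WT J n ≃ V) (X : Sym2 V → ℝ)
    (σ : V → ℝ) : cutValue (HG φ) X σ = 1/2 * ∑ e, (X (edg φ e) - cOf φ X σ e) := by
  unfold cutValue
  congr 1
  have : Finset.univ.filter (fun e => e ∈ (HG φ).edgeSet) = Finset.univ.image (edg φ) := by
    ext x; simp [HG_edgeSet]
  rw [this, Finset.sum_image (fun _ _ _ _ h => edg_inj φ h)]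
  refine Finset.sum_congr rfl fun e _ => ?_
  simp only [cOf, edg, Sym2.lift_mk]
  ring

lemma cOf_flip {J n : ℕ} {V : Type*} [Fintype V] (φ : WT J n ≃ V) (X : Sym2 V → ℝ)
    (σ : V → ℝ) (T : Finset (WT J n)) :
    cOf φ X (flip σ (T.map φ.toEmbedding)) = act (cOf φ X σ) T := by
  ext e
  simp only [cOf, act, flip, xf]
  have hm : ∀ x, φ x ∈ T.map φ.toEmbedding ↔ x ∈ T := by intro x; simp
  simp only [hm, Xor]
  by_cases h1 : Sum.inr e ∈ T <;> by_cases h2 : parW e ∈ T <;> simp [h1, h2]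

lemma impr_eq {J n : ℕ} {V : Type*} [Fintype V] (φ : WT J n ≃ V) (X : Sym2 V → ℝ)
    (σ : V → ℝ) (T : Finset (WT J n)) :
    impr (HG φ) X σ (T.map φ.toEmbedding) = gain (cOf φ X σ) T := by
  unfold impr gain
  rw [cutValue_eq, cutValue_eq, cOf_flip, ← mul_sub, ← Finset.sum_sub_distrib, Finset.mul_sum]
  refine Finset.sum_congr rfl fun e _ => ?_
  unfold act
  split_ifs <;> ring

lemma improving_of {J n : ℕ} {V : Type*} [Fintype V] (φ : WT J n ≃ V) (X : Sym2 V → ℝ)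
    (L : List (Finset (WT J n))) : ∀ σ, ImpC (cOf φ X σ) L →
    Improving (HG φ) X σ (L.map (fun T => T.map φ.toEmbedding)) := by
  induction L with
  | nil => intro σ _; trivial
  | cons T L ih =>
    intro σ h
    refine ⟨?_, ?_⟩
    · rw [impr_eq]; exact h.1
    · apply ih; rw [cOf_flip]; exact h.2

end PD

section PD2

noncomputable def tau {J : ℕ} (s : Fin J) : ℝ := (1/8 : ℝ) ^ (J - (s : ℕ))

lemma tau_pos {J : ℕ} (s : Fin J) : 0 < tau s := by unfold tau; positivity

lemma tau_lt {J : ℕ} {s t : Fin J} (h : s < t) : 8 * tau s ≤ tau t := by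
  unfold tau
  have h' : (s : ℕ) < t := h
  have ht := t.2
  obtain ⟨d, hd⟩ : ∃ d, J - (s:ℕ) = (J - (t:ℕ)) + (d + 1) := ⟨(t:ℕ) - s - 1, by omega⟩
  rw [hd, pow_add, pow_succ]
  have h1 : (1/8:ℝ) ^ d ≤ 1 := pow_le_one₀ (by norm_num) (by norm_num)
  have h2 : (0:ℝ) < (1/8:ℝ) ^ (J - (t:ℕ)) := by positivity
  nlinarith

def good (b : ℝ) {J n : ℕ} (s : Fin J) (v : Fin n → Fin 3 → ℝ) : Prop :=
  Hit WW (FF b) (tau s) {-(2 * tau s)} v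

def str {J n : ℕ} (c : EE J n → ℝ) (s : Fin J) : Fin n → Fin 3 → ℝ := fun i j => c (s, i, j)

lemma FF_pos {b : ℝ} {u : Fin 3 → ℝ} (h : u ∈ FF b) : 0 < u 0 + u 1 + u 2 := by
  obtain ⟨h1, h2, h3⟩ := h
  have : 0 ≤ bet b := abs_nonneg _
  linarith [h1.1, h2.2]

lemma det (b : ℝ) {J n : ℕ} (c : EE J n → ℝ) (k : ℕ) (hk : 1 ≤ k)
    (hc : 2 * k ≤ (Finset.univ.filter (fun s : Fin J => good b s (str c s))).card) :
    ∃ L : List (Finset (WT J n)), ImpC c L ∧ (∀ T ∈ L, T.card ≤ 3) ∧ 2 ^ (k - 1) ≤ L.length := by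
  have hg : ∀ s : Fin J, ∃ ε : Fin n → Bool, good b s (str c s) →
      (∀ i, ε i = true → str c s i ∈ FF b) ∧
      tau s ≤ ∑ i, (if ε i = true then - WW (str c s i) else WW (str c s i)) ∧
      ∑ i, (if ε i = true then - WW (str c s i) else WW (str c s i)) ≤ 2 * tau s := by
    intro s
    by_cases h : good b s (str c s)
    · obtain ⟨ε, h1, a, ha, h2, h3⟩ := h
      rw [Finset.mem_singleton] at ha
      subst ha
      exact ⟨ε, fun _ => ⟨h1, by linarith, by linarith⟩⟩
    · exact ⟨fun _ => false, fun h' => absurd h' h⟩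
  choose ε hε using hg
  set G := Finset.univ.filter (fun s : Fin J => good b s (str c s)) with hG
  set l := (Finset.univ.filter (fun p : Fin J × Fin n => p.1 ∈ G ∧ ε p.1 p.2 = true)).toList with hl
  have hlm : ∀ p, p ∈ l ↔ p.1 ∈ G ∧ ε p.1 p.2 = true := by intro p; simp [hl]
  have hGg : ∀ s, s ∈ G ↔ good b s (str c s) := by intro s; simp [hG]
  obtain ⟨i1, e1⟩ := impC_unt l (Finset.nodup_toList _) c (by
    intro p hp
    obtain ⟨h1, h2⟩ := (hlm p).1 hp
    exact FF_pos ((hε p.1 ((hGg _).1 h1)).1 p.2 h2))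
  set c' := acts c (l.map unt) with hc'
  have hf : ∀ s ∈ G, tau s ≤ fld c' s ∧ fld c' s ≤ 2 * tau s := by
    intro s hs
    have : fld c' s = ∑ i, (if ε s i = true then - WW (str c s i) else WW (str c s i)) := by
      unfold fld
      refine Finset.sum_congr rfl fun i _ => ?_
      rw [e1]
      simp only [hlm, hs, true_and, WW, str]
      split_ifs <;> ring
    rw [this]
    exact (hε s ((hGg s).1 hs)).2
  let g := G.orderEmbOfCardLe hc
  have hgm : ∀ i, g i ∈ G := fun i => G.orderEmbOfCardLe_mem hc i
  let a : ℕ → Fin J := fun i => if h : i < 2 * k then g ⟨i, h⟩ else g ⟨0, by omega⟩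
  have ha : ∀ i (h : i < 2 * k), a i = g ⟨i, h⟩ := fun i h => dif_pos h
  have hag : ∀ i, a i ∈ G := by
    intro i; simp only [a]; split_ifs <;> exact hgm _
  have halt : ∀ i i', i < i' → i' < 2 * k → a i < a i' := by
    intro i i' h h'
    rw [ha i (h.trans h'), ha i' h']
    exact g.strictMono h
  have himp := (cL_imp (fld c') a (k - 1) (fun i i' h h' => (halt i i' h (by omega)).ne)
    (lt_of_lt_of_le (tau_pos _) (hf _ (hag 0)).1) ?_ ?_ ∅ (by simp)).1
  · refine ⟨l.map unt ++ (cL a (k-1)).map cen, ?_, ?_, ?_⟩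
    · rw [impC_append]
      refine ⟨i1, ?_⟩
      have := impC_cen c' _ _ himp
      have e : stt c' ∅ = c' := by ext e; simp [stt]
      rwa [e] at this
    · intro T hT
      rw [List.mem_append, List.mem_map, List.mem_map] at hT
      rcases hT with ⟨p, -, rfl⟩ | ⟨D, hD, rfl⟩
      · exact Finset.card_le_two.trans (by norm_num)
      · rw [cen, Finset.card_map]; exact cL_card a _ D hD
    · rw [List.length_append, List.length_map, List.length_map]
      exact (cL_len a (k-1)).trans (Nat.le_add_left _ _)
  · intro i hi
    have h1 := tau_lt (halt i (i+1) (by omega) (by omega))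
    have h2 := tau_pos (a i)
    linarith [(hf _ (hag i)).2, (hf _ (hag (i+1))).1]
  · intro i hi
    have h1 := tau_lt (halt i (i+1) (by omega) (by omega))
    have h3 := tau_lt (halt (i+1) (i+2) (by omega) (by omega))
    have h2 := tau_pos (a i)
    linarith [(hf _ (hag i)).2, (hf _ (hag (i+1))).2, (hf _ (hag (i+2))).1]

lemma det' (b : ℝ) {J n : ℕ} {V : Type*} [Fintype V] (φ : WT J n ≃ V) (X : Sym2 V → ℝ)
    (σ : V → ℝ) (k : ℕ) (hk : 1 ≤ k)
    (hc : 2 * k ≤ (Finset.univ.filter (fun s : Fin J => good b s (str (cOf φ X σ) s))).card) :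
    ∃ L : List (Finset V), (∀ S ∈ L, S.card ≤ 3) ∧ Improving (HG φ) X σ L ∧
      2 ^ (k - 1) ≤ L.length := by
  obtain ⟨L, h1, h2, h3⟩ := det b _ k hk hc
  refine ⟨L.map (fun T => T.map φ.toEmbedding), ?_, improving_of φ X L σ h1, by simpa using h3⟩
  intro S hS
  rw [List.mem_map] at hS
  obtain ⟨T, hT, rfl⟩ := hS
  rw [Finset.card_map]
  exact h2 T hT

end PD2

section PC1

def theta (J n : ℕ) : (WT J n → Bool) ≃ (Fin J → Bool) × (EE J n → Bool) where
  toFun f := (fun s => f (Sum.inl s), fun e => xor (f (Sum.inr e)) (f (parW e)))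
  invFun p := Sum.elim p.1 (fun e => if e.2.2 = 2 then xor (p.2 e)
    (xor (p.2 (e.1, e.2.1, 0)) (p.1 e.1)) else xor (p.2 e) (p.1 e.1))
  left_inv f := by
    funext x
    rcases x with s | ⟨s, i, j⟩
    · rfl
    · by_cases h : j = 2
      · subst h
        simp [parW]
      · simp [parW, h]
  right_inv p := by
    rcases p with ⟨r, t⟩
    ext x
    · rfl
    · obtain ⟨s, i, j⟩ := x
      by_cases h : j = 2
      · subst h
        simp [parW]
      · simp [parW, h]

lemma sum_sign {J n : ℕ} (q : EE J n → Bool → ℝ≥0∞) :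
    ∑ f : WT J n → Bool, ∏ e, q e (xor (f (Sum.inr e)) (f (parW e)))
      = 2 ^ J * ∏ e, (q e false + q e true) := by
  have h1 : ∑ f : WT J n → Bool, ∏ e, q e (xor (f (Sum.inr e)) (f (parW e)))
      = ∑ p : (Fin J → Bool) × (EE J n → Bool), ∏ e, q e (p.2 e) :=
    Fintype.sum_equiv (theta J n) _ _ (fun f => rfl)
  rw [h1, Fintype.sum_prod_type]
  have h2 : ∑ t : EE J n → Bool, ∏ e, q e (t e) = ∏ e, (q e false + q e true) := by
    have := Finset.prod_univ_sum (fun _ : EE J n => (Finset.univ : Finset Bool)) q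
    rw [Fintype.piFinset_univ] at this
    rw [← this]
    exact Finset.prod_congr rfl (fun e _ => by rw [Fintype.sum_bool, add_comm])
  simp only [h2]
  simp

lemma sum_sign' {J n : ℕ} {V : Type*} [Fintype V] [DecidableEq V] (φ : WT J n ≃ V) (q : EE J n → Bool → ℝ≥0∞) :
    ∑ f : V → Bool, (Fintype.card (V → Bool) : ℝ≥0∞)⁻¹ *
        ∏ e, q e (xor (f (φ (Sum.inr e))) (f (φ (parW e))))
      = ∏ e, (2⁻¹ * (q e false + q e true)) := by
  rw [← Finset.mul_sum]
  have h1 : ∑ f : V → Bool, ∏ e, q e (xor (f (φ (Sum.inr e))) (f (φ (parW e))))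
     = 2 ^ J * ∏ e, (q e false + q e true) := by
    rw [← sum_sign]
    exact Fintype.sum_equiv (Equiv.arrowCongr φ.symm (Equiv.refl Bool)) _ _ (fun f => rfl)
  rw [h1, Finset.prod_mul_distrib, ← mul_assoc]
  congr 1
  have hc : Fintype.card (V → Bool) = 2 ^ J * 2 ^ (Fintype.card (EE J n)) := by
    rw [Fintype.card_fun, Fintype.card_bool, ← Fintype.card_congr φ, ← pow_add]
    congr 1
    unfold WT
    rw [Fintype.card_sum, Fintype.card_fin]
  rw [hc, Finset.prod_const, Finset.card_univ]
  push_cast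
  rw [ENNReal.mul_inv (by simp) (by simp), mul_comm, ← mul_assoc,
    ENNReal.mul_inv_cancel (by simp) (by simp), one_mul, ENNReal.inv_pow]

lemma uni_eq (b : ℝ) : uniformIcc b (b+1) = volume.restrict (Set.Icc b (b+1)) := by
  simp [uniformIcc]

lemma kap_eq (b : ℝ) {M : Set ℝ} (hM : MeasurableSet M) :
    kap b M = 2⁻¹ * (volume.restrict (Set.Icc b (b+1)) M +
      volume.restrict (Set.Icc b (b+1)) ((fun x => -x) ⁻¹' M)) := by
  rw [kap_apply b hM, Measure.restrict_apply hM, Measure.restrict_apply (measurable_neg hM)]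
  congr 2
  rw [← (Measure.measurePreserving_neg (volume : Measure ℝ)).measure_preimage_equiv
    (f := MeasurableEquiv.neg ℝ)]
  congr 1
  ext x
  simp

end PC1

section PC2

noncomputable def sgnB (t : Bool) : ℝ := if t then -1 else 1

lemma law_abs {J n : ℕ} {V : Type*} [Fintype V] [DecidableEq V] (φ : WT J n ≃ V) (b : ℝ)
    {Ω : Type*} [MeasurableSpace Ω] (P : Measure Ω) [IsProbabilityMeasure P]
    (x : Ω → EE J n → ℝ) (σb : Ω → V → Bool) (hx : Measurable x) (hs : Measurable σb)
    (hlx : P.map x = Measure.pi (fun _ => uniformIcc b (b+1)))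
    (hls : P.map σb = (PMF.uniformOfFintype (V → Bool)).toMeasure)
    (hi : IndepFun x σb P) :
    P.map (fun ω e => sgnB (xor (σb ω (φ (Sum.inr e))) (σb ω (φ (parW e)))) * x ω e)
      = Measure.pi (fun _ => kap b) := by
  rw [indepFun_iff_map_prod_eq_prod_map_map hx.aemeasurable hs.aemeasurable, hlx, hls] at hi
  rw [uni_eq] at hi
  have hG : Measurable (fun p : (EE J n → ℝ) × (V → Bool) => fun e : EE J n =>
      sgnB (xor (p.2 (φ (Sum.inr e))) (p.2 (φ (parW e)))) * p.1 e) := by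
    refine measurable_pi_lambda _ (fun e => Measurable.mul ?_ ?_)
    · exact (measurable_of_finite (fun σ : V → Bool =>
        sgnB (xor (σ (φ (Sum.inr e))) (σ (φ (parW e)))))).comp measurable_snd
    · exact (measurable_pi_apply e).comp measurable_fst
  have hcomp : P.map (fun ω e => sgnB (xor (σb ω (φ (Sum.inr e))) (σb ω (φ (parW e)))) * x ω e)
      = (P.map (fun ω => (x ω, σb ω))).map (fun p : (EE J n → ℝ) × (V → Bool) => fun e : EE J n =>
      sgnB (xor (p.2 (φ (Sum.inr e))) (p.2 (φ (parW e)))) * p.1 e) := by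
    rw [Measure.map_map hG (hx.prodMk hs)]
    rfl
  rw [hcomp, hi]
  symm
  refine Measure.pi_eq (fun M hM => ?_)
  have hbox : MeasurableSet (Set.pi Set.univ M) := MeasurableSet.univ_pi hM
  rw [Measure.map_apply hG hbox, Measure.prod_apply_symm (hG hbox), lintegral_fintype]
  set q : EE J n → Bool → ℝ≥0∞ := fun e t =>
    volume.restrict (Set.Icc b (b+1)) ((fun y => sgnB t * y) ⁻¹' (M e)) with hq
  have hsl : ∀ σ : V → Bool, (Measure.pi (fun _ : EE J n => volume.restrict (Set.Icc b (b+1))))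
      ((fun y => (y, σ)) ⁻¹' ((fun p : (EE J n → ℝ) × (V → Bool) => fun e : EE J n =>
      sgnB (xor (p.2 (φ (Sum.inr e))) (p.2 (φ (parW e)))) * p.1 e) ⁻¹' Set.pi Set.univ M))
      = ∏ e, q e (xor (σ (φ (Sum.inr e))) (σ (φ (parW e)))) := by
    intro σ
    rw [hq, ← Measure.pi_pi]
    rfl
  have hw : ∀ σ : V → Bool, (PMF.uniformOfFintype (V → Bool)).toMeasure {σ} =
      (Fintype.card (V → Bool) : ℝ≥0∞)⁻¹ := by
    intro σ
    rw [PMF.toMeasure_apply_singleton _ _ (measurableSet_singleton σ),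
      PMF.uniformOfFintype_apply]
  simp only [hsl, hw]
  rw [show (∏ e, kap b (M e)) = ∏ e, (2⁻¹ * (q e false + q e true)) from ?_]
  · rw [← sum_sign' φ q]
    exact Finset.sum_congr rfl (fun f _ => mul_comm _ _)
  · refine Finset.prod_congr rfl (fun e _ => ?_)
    rw [kap_eq b (hM e)]
    simp [hq, sgnB]

lemma curry_pi (b : ℝ) (J n : ℕ) :
    (Measure.pi (fun _ : EE J n => kap b)).map (fun c (s : Fin J) => str c s) =
      Measure.pi (fun _ : Fin J => Measure.pi (fun _ : Fin n => nu b)) := by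
  set Q := Measure.pi (fun _ : Fin J => Measure.pi (fun _ : Fin n => nu b)) with hQ
  have hm : Measurable (fun (c : EE J n → ℝ) (s : Fin J) => str c s) := by
    unfold str
    fun_prop
  have hm' : Measurable (fun (u : Fin J → Fin n → Fin 3 → ℝ) (e : EE J n) => u e.1 e.2.1 e.2.2) := by
    fun_prop
  have h : Measure.pi (fun _ : EE J n => kap b) = Q.map (fun u e => u e.1 e.2.1 e.2.2) := by
    refine Measure.pi_eq (fun M hM => ?_)
    rw [Measure.map_apply hm' (MeasurableSet.univ_pi hM)]
    have : ((fun (u : Fin J → Fin n → Fin 3 → ℝ) (e : EE J n) => u e.1 e.2.1 e.2.2) ⁻¹'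
      (Set.pi Set.univ M)) = Set.pi Set.univ (fun s => Set.pi Set.univ (fun i => Set.pi Set.univ
        (fun j => M (s, i, j)))) := by
      ext u
      simp only [Set.mem_preimage, Set.mem_univ_pi]
      exact ⟨fun h s i j => h (s, i, j), fun h e => h e.1 e.2.1 e.2.2⟩
    rw [this, hQ, Measure.pi_pi]
    unfold EE
    rw [Fintype.prod_prod_type]
    refine Finset.prod_congr rfl (fun s _ => ?_)
    rw [Measure.pi_pi, Fintype.prod_prod_type]
    refine Finset.prod_congr rfl (fun i _ => ?_)
    rw [nu, Measure.pi_pi]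
  rw [h, Measure.map_map hm hm']
  exact Measure.map_id

lemma cOf_eq {J n : ℕ} {V : Type*} (φ : WT J n ≃ V) (X : Sym2 V → ℝ) (f : V → Bool) (e : EE J n) :
    cOf φ X (toCut f) e = sgnB (xor (f (φ (Sum.inr e))) (f (φ (parW e)))) * X (edg φ e) := by
  unfold cOf toCut sgnB
  cases f (φ (Sum.inr e)) <;> cases f (φ (parW e)) <;> simp

lemma law_str {J n : ℕ} {V : Type*} [Fintype V] [DecidableEq V] (φ : WT J n ≃ V) (b : ℝ)
    {Ω : Type*} [MeasurableSpace Ω] (P : Measure Ω) [IsProbabilityMeasure P]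
    (X : (HG φ).edgeSet → Ω → ℝ) (σb : Ω → V → Bool) (hX : ∀ e, Measurable (X e))
    (hiX : iIndepFun X P)
    (hlX : ∀ e, Measure.map (X e) P = uniformIcc b (b + 1))
    (hs : Measurable σb)
    (hls : P.map σb = (PMF.uniformOfFintype (V → Bool)).toMeasure)
    (hi : IndepFun (fun ω e => X e ω) σb P) :
    Measurable (fun ω (s : Fin J) => str (cOf φ (fun e => if h : e ∈ (HG φ).edgeSet then X ⟨e, h⟩ ω else 0)
      (toCut (σb ω))) s) ∧
    P.map (fun ω (s : Fin J) => str (cOf φ (fun e => if h : e ∈ (HG φ).edgeSet then X ⟨e, h⟩ ω else 0)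
      (toCut (σb ω))) s) =
      Measure.pi (fun _ : Fin J => Measure.pi (fun _ : Fin n => nu b)) := by
  have hmem : ∀ e : EE J n, edg φ e ∈ (HG φ).edgeSet := fun e => by
    rw [HG_edgeSet]; exact Set.mem_range_self e
  let g : EE J n → (HG φ).edgeSet := fun e => ⟨edg φ e, hmem e⟩
  have hg : Function.Injective g := fun e e' h => edg_inj φ (congrArg Subtype.val h)
  let x : Ω → EE J n → ℝ := fun ω e => X (g e) ω
  have hx : Measurable x := measurable_pi_lambda _ (fun e => hX _)
  have hlx : P.map x = Measure.pi (fun _ => uniformIcc b (b+1)) := by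
    have h1 := hiX.precomp hg
    rw [iIndepFun_iff_map_fun_eq_pi_map (fun e => (hX _).aemeasurable)] at h1
    have h2 : (fun i => P.map (X (g i))) = fun _ : EE J n => uniformIcc b (b+1) := by
      funext i; exact hlX _
    rw [h2] at h1
    exact h1
  have hix : IndepFun x σb P := by
    have hr : Measurable (fun (y : (HG φ).edgeSet → ℝ) (e : EE J n) => y (g e)) := by fun_prop
    exact hi.comp hr measurable_id
  have hl := law_abs φ b P x σb hx hs hlx hls hix
  have hc : (fun ω => cOf φ (fun e => if h : e ∈ (HG φ).edgeSet then X ⟨e, h⟩ ω else 0)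
      (toCut (σb ω))) = (fun ω e => sgnB (xor (σb ω (φ (Sum.inr e))) (σb ω (φ (parW e)))) * x ω e) := by
    funext ω e
    rw [cOf_eq, dif_pos (hmem e)]
  have hcm : Measurable (fun ω => cOf φ (fun e => if h : e ∈ (HG φ).edgeSet then X ⟨e, h⟩ ω else 0)
      (toCut (σb ω))) := by
    rw [hc]
    refine measurable_pi_lambda _ (fun e => Measurable.mul ?_ ?_)
    · exact (measurable_of_finite (fun σ : V → Bool =>
        sgnB (xor (σ (φ (Sum.inr e))) (σ (φ (parW e)))))).comp hs
    · exact (measurable_pi_apply e).comp hx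
  have hm : Measurable (fun (c : EE J n → ℝ) (s : Fin J) => str c s) := by
    unfold str
    fun_prop
  refine ⟨hm.comp hcm, ?_⟩
  rw [← curry_pi, ← hl, ← hc, Measure.map_map hm hcm]
  rfl

end PC2

section PE

lemma measurableSet_good (b : ℝ) {J n : ℕ} (s : Fin J) :
    MeasurableSet {v : Fin n → Fin 3 → ℝ | good b s v} :=
  measurableSet_hit WW measurable_WW (FF b) (measurableSet_FF b) (tau s) _

lemma chern (b : ℝ) {J n : ℕ} (p : ℝ) (hp0 : 0 < p) (hp1 : p ≤ 1) (k : ℕ)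
    (hf : ∀ s : Fin J, (Measure.pi (fun _ : Fin n => nu b)) {v | ¬ good b s v} ≤ ENNReal.ofReal (1-p)) :
    (Measure.pi (fun _ : Fin J => Measure.pi (fun _ : Fin n => nu b))).real
      {u | ¬ 2 * k ≤ (univ.filter (fun s => good b s (u s))).card} ≤ 4 ^ k * (1 - p/2) ^ J := by
  set μ := Measure.pi (fun _ : Fin n => nu b) with hμ
  let h : Fin J → (Fin n → Fin 3 → ℝ) → ℝ := fun s v => 1/2 + 1/2 * Set.indicator {v | ¬ good b s v} 1 v
  have hms : ∀ s : Fin J, MeasurableSet {v : Fin n → Fin 3 → ℝ | ¬ good b s v} :=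
    fun s => (measurableSet_good b s).compl
  have hind : ∀ s : Fin J, Integrable (Set.indicator {v | ¬ good b s v} (1 : (Fin n → Fin 3 → ℝ) → ℝ)) μ :=
    fun s => (integrable_const (1:ℝ)).indicator (hms s)
  have hint : ∀ s, Integrable (h s) μ := fun s => (integrable_const _).add ((hind s).const_mul _)
  have hpos : ∀ s v, 0 ≤ h s v := fun s v => by
    have : (0:ℝ) ≤ Set.indicator {v | ¬ good b s v} 1 v := Set.indicator_nonneg (fun _ _ => zero_le_one) v
    simp only [h]; linarith
  have hval : ∀ s v, h s v = if good b s v then 1/2 else 1 := fun s v => by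
    by_cases hg : good b s v <;> simp [h, hg] <;> norm_num
  have hE : ∀ s, ∫ v, h s v ∂μ ≤ 1 - p/2 := fun s => by
    simp only [h]
    rw [integral_add (integrable_const _) ((hind s).const_mul _), integral_const_mul,
      integral_indicator_one (hms s)]
    have : μ.real {v | ¬ good b s v} ≤ 1 - p := ENNReal.toReal_le_of_le_ofReal (by linarith) (hf s)
    simp
    linarith
  have hM := mul_meas_ge_le_integral_of_nonneg (μ := Measure.pi (fun _ : Fin J => μ))
    (f := fun u => ∏ s, h s (u s)) (ae_of_all _ (fun u => Finset.prod_nonneg (fun s _ => hpos s _)))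
    (Integrable.fintype_prod hint) ((1/4)^k)
  have hP : ∫ u, ∏ s, h s (u s) ∂(Measure.pi (fun _ : Fin J => μ)) ≤ (1 - p/2)^J := by
    rw [integral_fintype_prod_eq_prod]
    calc _ ≤ ∏ s : Fin J, (1 - p/2) := Finset.prod_le_prod
            (fun s _ => integral_nonneg (hpos s)) (fun s _ => hE s)
      _ = _ := by simp
  have hsub : {u : Fin J → Fin n → Fin 3 → ℝ | ¬ 2 * k ≤ (univ.filter (fun s => good b s (u s))).card}
      ⊆ {u | (1/4:ℝ)^k ≤ ∏ s, h s (u s)} := by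
    intro u hu
    simp only [Set.mem_ofPred_eq, not_le] at hu ⊢
    simp only [hval]
    rw [Finset.prod_ite]
    simp only [Finset.prod_const, one_pow, mul_one]
    calc (1/4:ℝ)^k = (1/2)^(2*k) := by rw [pow_mul]; norm_num
      _ ≤ _ := pow_le_pow_of_le_one (by norm_num) (by norm_num) hu.le
  have hmono := measureReal_mono (μ := Measure.pi (fun _ : Fin J => μ)) hsub
  have h4 : (4:ℝ)^k * (1/4)^k = 1 := by rw [← mul_pow]; norm_num
  have h4p : (0:ℝ) < 4^k := by positivity
  have h5 := mul_le_mul_of_nonneg_left (hM.trans hP) h4p.le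
  rw [← mul_assoc, h4, one_mul] at h5
  exact hmono.trans h5

lemma good_event (b : ℝ) (J n k : ℕ) : MeasurableSet {u : Fin J → Fin n → Fin 3 → ℝ |
    2 * k ≤ (univ.filter (fun s => good b s (u s))).card} := by
  have : (fun u : Fin J → Fin n → Fin 3 → ℝ => (univ.filter (fun s => good b s (u s))).card) =
      fun u => ∑ s, Set.indicator {u : Fin J → Fin n → Fin 3 → ℝ | good b s (u s)} (fun _ => 1) u := by
    funext u
    rw [Finset.card_filter]
    rfl
  have hm : Measurable (fun u : Fin J → Fin n → Fin 3 → ℝ =>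
      (univ.filter (fun s => good b s (u s))).card) := by
    rw [this]
    refine Finset.measurable_sum _ (fun s _ => measurable_const.indicator ?_)
    exact (measurable_pi_apply (X := fun _ : Fin J => Fin n → Fin 3 → ℝ) s) (measurableSet_good b s)
  exact measurableSet_le measurable_const hm

lemma tau_ge {J : ℕ} (s : Fin J) : (1/8:ℝ)^J ≤ tau s :=
  pow_le_pow_of_le_one (by norm_num) (by norm_num) (Nat.sub_le _ _)

lemma tau_le {J : ℕ} (s : Fin J) : tau s ≤ 1/8 := by
  have h := s.2
  calc tau s ≤ (1/8:ℝ)^1 := pow_le_pow_of_le_one (by norm_num) (by norm_num) (by omega)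
    _ = _ := by norm_num

lemma final (b : ℝ) :
    ∃ C : ℝ, 0 < C ∧
      ∃ (N : ℕ → ℕ) (H : ∀ k, SimpleGraph (Fin (N k))),
        (∀ k : ℕ, (N k : ℝ) ≤ C * k ^ 2) ∧
        ∀ ε : ℝ, 0 < ε → ∃ K : ℕ, ∀ k : ℕ, K ≤ k →
          ∀ (Ω : Type) (_ : MeasurableSpace Ω) (P : Measure Ω), IsProbabilityMeasure P →
            ∀ (X : (H k).edgeSet → Ω → ℝ) (σb : Ω → (Fin (N k) → Bool)),
              (∀ e, Measurable (X e)) →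
              iIndepFun X P →
              (∀ e, Measure.map (X e) P = uniformIcc b (b + 1)) →
              Measurable σb →
              Measure.map σb P = (PMF.uniformOfFintype (Fin (N k) → Bool)).toMeasure →
              IndepFun (fun ω e => X e ω) σb P →
              ENNReal.ofReal (1 - ε) ≤
                P {ω | ∃ L : List (Finset (Fin (N k))),
                  (∀ S ∈ L, S.card ≤ 3) ∧
                  Improving (H k)
                    (fun e => if h : e ∈ (H k).edgeSet then X ⟨e, h⟩ ω else 0)
                    (toCut (σb ω)) L ∧
                  2 ^ (k - 1) ≤ L.length} := by
  obtain ⟨p, D, J0, hp0, hp1, hA⟩ := partA (nu_facts b)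
  obtain ⟨D3, hD3⟩ := exists_pow_lt_of_lt_one (show (0:ℝ) < 1/8 by norm_num)
    (show (1 - p/2) < 1 by linarith)
  have hr0 : 0 ≤ 1 - p/2 := by linarith
  have hD3p : 1 ≤ D3 := by
    rcases Nat.eq_zero_or_pos D3 with h | h
    · subst h; norm_num at hD3
    · exact h
  obtain ⟨N, hN, ⟨φ⟩⟩ : ∃ N : ℕ → ℕ, (∀ k, N k = D3*k + D3*k*(D*(D3*k)*3)) ∧
      Nonempty (∀ k, WT (D3*k) (D*(D3*k)) ≃ Fin (N k)) :=
    ⟨fun k => D3*k + D3*k*(D*(D3*k)*3), fun k => rfl,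
      ⟨fun k => Fintype.equivFinOfCardEq (by simp [WT, EE, mul_assoc])⟩⟩
  refine ⟨D3 + 3 * D * D3^2, by positivity, N, fun k => HG (φ k), ?_, ?_⟩
  · intro k
    rw [hN]
    push_cast
    have hk : (k:ℝ) ≤ k^2 := by exact_mod_cast Nat.le_self_pow (by norm_num) k
    have : (D3:ℝ) * k ≤ D3 * k^2 := mul_le_mul_of_nonneg_left hk (by positivity)
    nlinarith
  · intro ε hε
    obtain ⟨K1, hK1⟩ := exists_pow_lt_of_lt_one hε (show (1/2:ℝ) < 1 by norm_num)
    refine ⟨max K1 (max J0 1), ?_⟩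
    intro k hk Ω mΩ P hP X σb hX hiX hlX hs hls hi
    have hk1 : K1 ≤ k := le_trans (le_max_left _ _) hk
    have hk2 : J0 ≤ k := le_trans (le_trans (le_max_left _ _) (le_max_right _ _)) hk
    have hk3 : 1 ≤ k := le_trans (le_trans (le_max_right _ _) (le_max_right _ _)) hk
    obtain ⟨hmeas, hlaw⟩ := law_str (φ k) b P X σb hX hiX hlX hs hls hi
    have hch := chern b (J := D3*k) (n := D*(D3*k)) p hp0 hp1 k (fun s =>
      (fail_link (nu b) WW measurable_WW (FF b) (measurableSet_FF b) (tau s) _ _).trans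
        (hA (D3*k) (tau s) (hk2.trans (Nat.le_mul_of_pos_left _ hD3p)) (tau_ge s) (tau_le s)))
    have hb : (4:ℝ)^k * (1-p/2)^(D3*k) ≤ ε := by
      rw [pow_mul, ← mul_pow]
      calc (4 * (1-p/2)^D3)^k ≤ (1/2:ℝ)^k := by
            apply pow_le_pow_left₀ (by positivity); linarith
        _ ≤ (1/2)^K1 := pow_le_pow_of_le_one (by norm_num) (by norm_num) hk1
        _ ≤ ε := hK1.le
    set Q := Measure.pi (fun _ : Fin (D3*k) => Measure.pi (fun _ : Fin (D*(D3*k)) => nu b)) with hQ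
    set A := {u : Fin (D3*k) → Fin (D*(D3*k)) → Fin 3 → ℝ |
      2 * k ≤ (univ.filter (fun s => good b s (u s))).card} with hAd
    have hmA : MeasurableSet A := good_event b _ _ k
    have hQA : 1 - ε ≤ Q.real A := by
      have h1 := probReal_compl_eq_one_sub (μ := Q) hmA
      have h2 : Q.real Aᶜ ≤ ε := hch.trans hb
      linarith
    have hQA' : ENNReal.ofReal (1 - ε) ≤ Q A := by
      rw [← ofReal_measureReal]
      exact ENNReal.ofReal_le_ofReal hQA
    refine hQA'.trans ?_
    rw [← hlaw, Measure.map_apply hmeas hmA]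
    refine measure_mono (fun ω hω => ?_)
    exact det' b (φ k) _ _ k hk3 hω

end PE

end Work

/-- For every real `b` there are `C > 0` and fixed graphs `H_k` on at most `C·k²`
vertices such that, for independent uniform `[b, b+1]` edge weights and an independent uniformly
random cut, the probability that there is an improving 3-flip sequence of length at least
`2^{k−1}` tends to `1` as `k → ∞`. -/
theorem three_flip_long_improving_sequences (b : ℝ) :
    ∃ C : ℝ, 0 < C ∧
      ∃ (N : ℕ → ℕ) (H : ∀ k, SimpleGraph (Fin (N k))),
        (∀ k : ℕ, (N k : ℝ) ≤ C * k ^ 2) ∧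
        ∀ ε : ℝ, 0 < ε → ∃ K : ℕ, ∀ k : ℕ, K ≤ k →
          ∀ (Ω : Type) (_ : MeasurableSpace Ω) (P : Measure Ω), IsProbabilityMeasure P →
            ∀ (X : (H k).edgeSet → Ω → ℝ) (σb : Ω → (Fin (N k) → Bool)),
              (∀ e, Measurable (X e)) →
              iIndepFun X P →
              (∀ e, Measure.map (X e) P = uniformIcc b (b + 1)) →
              Measurable σb →
              Measure.map σb P = (PMF.uniformOfFintype (Fin (N k) → Bool)).toMeasure →
              IndepFun (fun ω e => X e ω) σb P →
              ENNReal.ofReal (1 - ε) ≤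
                P {ω | ∃ L : List (Finset (Fin (N k))),
                  (∀ S ∈ L, S.card ≤ 3) ∧
                  Improving (H k)
                    (fun e => if h : e ∈ (H k).edgeSet then X ⟨e, h⟩ ω else 0)
                    (toCut (σb ω)) L ∧
                  2 ^ (k - 1) ≤ L.length} := by
  exact final b

end MaxCut
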